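/- arXiv:1302.4041 — 10 statements merged into one kernel-verified Lean document; each statement's English description precedes it below -/
import Mathlib

section
/- Every nontrivial attractor–repellor map h of S² admits a C^∞ complete Lyapunov function, i.e., a function H : S² → ℝ which is C^∞ with respect to the standard smooth structure of S² and satisfies: H(h(x)) < H(x) whenever x is not chain recurrent; for chain recurrent points x, y, H(x) = H(y) if and only if x ∼ y; and H(C) is a closed Lebesgue-null subset of ℝ, where C is the chain recurrent set of h. -/
noncomputable section

open Metric Set Function Filter MeasureTheory Topology Manifold

/-- The circle `ℝ/ℤ`. -/
abbrev Circle1 : Type := AddCircle (1 : ℝ)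

/-- The open annulus `𝔸 = S¹ × ℝ`. -/
abbrev Ann : Type := Circle1 × ℝ

/-- The universal covering map `π : ℝ² → 𝔸`, `π(x,t) = (x mod 1, t)`. -/
def annP : ℝ × ℝ → Ann := fun p => ((p.1 : Circle1), p.2)

/-- The `k`-th power of the generating deck transformation `T(x,t) = (x+1,t)`. -/
def deckPow (k : ℤ) : ℝ × ℝ → ℝ × ℝ := fun p => (p.1 + (k : ℝ), p.2)

/-- `ht` is a (continuous) lift of the annulus map `hA` through `annP`. -/
def IsAnnulusLift (hA : Ann → Ann) (ht : ℝ × ℝ → ℝ × ℝ) : Prop :=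
  Continuous ht ∧ ∀ p : ℝ × ℝ, annP (ht p) = hA (annP p)

/-- `φ : 𝔸 → ℝ` is the (continuous) descent of `Π₁ ∘ h̃ − Π₁` to the annulus. -/
def DescendsTo (ht : ℝ × ℝ → ℝ × ℝ) (φ : Ann → ℝ) : Prop :=
  Continuous φ ∧ ∀ p : ℝ × ℝ, φ (annP p) = (ht p).1 - p.1

/-- Rotation number of a periodic point `x` of period `q`:
`rot(h̃, x) = (1/q) Σ_{i<q} φ(h^i(x))`. -/
def rotPer (hA : Ann → Ann) (φ : Ann → ℝ) (q : ℕ) (x : Ann) : ℝ :=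
  (∑ i ∈ Finset.range q, φ (hA^[i] x)) / (q : ℝ)

/-- Rotation number of an invariant measure: `rot(h̃, μ) = ∫ φ dμ`. -/
def rotMeas (φ : Ann → ℝ) (μ : Measure Ann) : ℝ := ∫ z, φ z ∂μ

/-- The rotation set over the invariant Borel probability measures supported on `K`. -/
def rotSet (hA : Ann → Ann) (φ : Ann → ℝ) (K : Set Ann) : Set ℝ :=
  {r | ∃ μ : Measure Ann, IsProbabilityMeasure μ ∧ μ.map hA = μ ∧ μ Kᶜ = 0 ∧ r = rotMeas φ μ}

/-- `h` is isotopic to the identity (through homeomorphisms). -/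
def IsotopicToId {X : Type*} [TopologicalSpace X] (h : X ≃ₜ X) : Prop :=
  ∃ F : ℝ → X ≃ₜ X, Continuous (fun p : ℝ × X => F p.1 p.2) ∧
    F 0 = Homeomorph.refl X ∧ F 1 = h

/-- `hA` preserves each of the two ends of the annulus. -/
def EndPreserving (hA : Ann → Ann) : Prop :=
  Tendsto (fun p : Ann => (hA p).2) (comap Prod.snd atTop) atTop ∧
  Tendsto (fun p : Ann => (hA p).2) (comap Prod.snd atBot) atBot

/-- Orientation- and end-preserving homeomorphism of the annulus. -/
def OrientEndPreserving (hA : Ann ≃ₜ Ann) : Prop :=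
  IsotopicToId hA ∧ EndPreserving ⇑hA

/-- `z 0, z 1, …, z r` is an `ε`-chain of `h` (of length `r ≥ 1`). -/
def IsEpsChain {X : Type*} [MetricSpace X] (h : X → X) (ε : ℝ) (r : ℕ) (z : ℕ → X) : Prop :=
  1 ≤ r ∧ ∀ i < r, dist (h (z i)) (z (i + 1)) < ε

/-- There is an `ε`-chain of `h` from `x` to `y`. -/
def EpsChainFromTo {X : Type*} [MetricSpace X] (h : X → X) (ε : ℝ) (x y : X) : Prop :=
  ∃ r z, IsEpsChain h ε r z ∧ z 0 = x ∧ z r = y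

/-- `x` is chain recurrent for `h`. -/
def ChainRecurrent {X : Type*} [MetricSpace X] (h : X → X) (x : X) : Prop :=
  ∀ ε > 0, EpsChainFromTo h ε x x

/-- `x` and `y` are chain transitive (`x ∼ y`). -/
def ChainEquiv {X : Type*} [MetricSpace X] (h : X → X) (x y : X) : Prop :=
  ChainRecurrent h x ∧ ChainRecurrent h y ∧
    ∀ ε > 0, EpsChainFromTo h ε x y ∧ EpsChainFromTo h ε y x

/-- `C₀` is a chain transitive class of `h`. -/
def IsChainClass {X : Type*} [MetricSpace X] (h : X → X) (C₀ : Set X) : Prop :=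
  ∃ x, ChainRecurrent h x ∧ C₀ = {y | ChainEquiv h x y}
/-- The standard 2-sphere. -/
abbrev S2 : Type := ↥(Metric.sphere (0 : EuclideanSpace ℝ (Fin 3)) 1)

instance : Fact (Module.finrank ℝ (EuclideanSpace ℝ (Fin 3)) = 2 + 1) := ⟨by simp⟩

/-- An open disk in `S²`: an open set homeomorphic to the open unit 2-disc. -/
def IsOpenDisk (V : Set S2) : Prop :=
  IsOpen V ∧ Nonempty (↥V ≃ₜ ↥(Metric.ball (0 : EuclideanSpace ℝ (Fin 2)) 1))

/-- `a` is an attractor of `h` with basin `W`. -/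
def AttractorWithBasin (h : S2 ≃ₜ S2) (a : S2) (W : Set S2) : Prop :=
  h a = a ∧ ∃ V : Set S2, IsOpenDisk V ∧ a ∈ V ∧ h '' closure V ⊆ V ∧
    (⋂ i : ℕ, (⇑h)^[i] '' V) = {a} ∧ W = ⋃ i : ℕ, (⇑h.symm)^[i] '' V

/-- `h` is a nontrivial attractor-repellor map of `S²`, with repellor `pinf` of basin
`Winf` and attractor `minf` of basin `Wminf`. -/
structure IsNontrivAR (h : S2 ≃ₜ S2) (pinf minf : S2) (Winf Wminf : Set S2) : Prop where
  distinct : pinf ≠ minf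
  orient : IsotopicToId h
  attractor : AttractorWithBasin h minf Wminf
  repellor : AttractorWithBasin h.symm pinf Winf
  nontrivial : (Set.univ \ (Wminf ∪ Winf)).Nonempty
  basins_meet : (Wminf ∩ Winf).Nonempty
/-- The chain recurrent set of `h`. -/
def chainRecSet (h : S2 → S2) : Set S2 := {x | ChainRecurrent h x}

/-- `H` is a complete Lyapunov function of `h`. -/
def IsCompleteLyapunov (h : S2 → S2) (H : S2 → ℝ) : Prop :=
  Continuous H ∧
  (∀ x, ¬ ChainRecurrent h x → H (h x) < H x) ∧
  (∀ x y, ChainRecurrent h x → ChainRecurrent h y → (H x = H y ↔ ChainEquiv h x y)) ∧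
  IsClosed (H '' chainRecSet h) ∧ volume (H '' chainRecSet h) = 0

/-- `c` is a regular value of the smooth function `H : S² → ℝ`. -/
def IsRegularValue (H : S2 → ℝ) (c : ℝ) : Prop :=
  ∀ x : S2, H x = c → Function.Surjective ⇑(mfderiv (𝓡 2) 𝓘(ℝ, ℝ) H x)

/-! ### Chains and trapping regions -/

section Chains

variable {X : Type*} [MetricSpace X] {h : X → X}

theorem epsChainFromTo_iff_transGen {ε : ℝ} {x y : X} :
    EpsChainFromTo h ε x y ↔ Relation.TransGen (fun a b => dist (h a) b < ε) x y := by
  constructor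
  · rintro ⟨r, z, ⟨hr, hz⟩, rfl, rfl⟩
    have key : ∀ n, n + 1 ≤ r →
        Relation.TransGen (fun a b => dist (h a) b < ε) (z 0) (z (n + 1)) := by
      intro n
      induction n with
      | zero => exact fun hn => .single (hz 0 hn)
      | succ n ih => exact fun hn => (ih (by omega)).tail (hz (n + 1) hn)
    obtain ⟨n, rfl⟩ : ∃ n, r = n + 1 := ⟨r - 1, by omega⟩
    exact key n le_rfl
  · intro hxy
    induction hxy with
    | @single b hb =>
      refine ⟨1, fun n => if n = 0 then x else b, ⟨le_rfl, fun i hi => ?_⟩, by simp, by simp⟩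
      obtain rfl : i = 0 := by omega
      simpa using hb
    | @tail b c _ hbc ih =>
      obtain ⟨r, z, ⟨hr, hz⟩, h0, rfl⟩ := ih
      refine ⟨r + 1, fun n => if n ≤ r then z n else c, ⟨by omega, fun i hi => ?_⟩,
        by simp [h0], by simp⟩
      rcases Nat.lt_or_ge i r with hir | hir
      · simpa [hir.le, Nat.succ_le_of_lt hir] using hz i hir
      · obtain rfl : i = r := by omega
        simpa using hbc

/-- A trapping region: an open set that is mapped into itself together with its closure. -/
structure IsTrapping (h : X → X) (U : Set X) : Prop where
  isOpen : IsOpen U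
  image_subset : h '' closure U ⊆ U

theorem isTrapping_setOf_epsChainFromTo (hc : Continuous h) {ε : ℝ} (hε : 0 < ε) (x : X) :
    IsTrapping h {y | EpsChainFromTo h ε x y} := by
  simp only [epsChainFromTo_iff_transGen]
  constructor
  · rw [isOpen_iff_mem_nhds]
    intro y hy
    rcases (Relation.TransGen.tail'_iff.1 hy) with ⟨b, hb, hby⟩
    have : ∀ᶠ y' in 𝓝 y, dist (h b) y' < ε :=
      (continuous_const.dist continuous_id).continuousAt.eventually_lt continuousAt_const hby
    filter_upwards [this] with y' hy'
    exact Relation.TransGen.tail' hb hy'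
  · rintro _ ⟨y, hy, rfl⟩
    have : ∀ᶠ y' in 𝓝 y, dist (h y') (h y) < ε :=
      (hc.dist continuous_const).continuousAt.eventually_lt continuousAt_const (by simpa using hε)
    obtain ⟨y', hy', hmem⟩ := mem_closure_iff_nhds.1 hy _ this
    exact Relation.TransGen.tail hmem hy'

/-- Sufficiently fine chains starting in a trapping region stay close to the image of its
closure. -/
theorem IsTrapping.exists_forall_epsChain_mem [CompactSpace X] (hc : Continuous h) {U V : Set X}
    (hU : IsTrapping h U) (hV : IsOpen V) (hKV : h '' closure U ⊆ V) :
    ∃ δ > 0, ∀ x ∈ U, ∀ y, EpsChainFromTo h δ x y → y ∈ V := by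
  obtain ⟨δ, hδ, hsub⟩ := (isClosed_closure.isCompact.image hc).exists_thickening_subset_open
    (hV.inter hU.isOpen) (subset_inter hKV hU.image_subset)
  refine ⟨δ, hδ, fun x hx y hxy => ?_⟩
  have step : ∀ a ∈ U, ∀ b, dist (h a) b < δ → b ∈ V ∩ U := fun a ha b hab =>
    hsub (mem_thickening_iff.2 ⟨h a, mem_image_of_mem h (subset_closure ha), by rwa [dist_comm]⟩)
  rw [epsChainFromTo_iff_transGen] at hxy
  suffices y ∈ V ∩ U from this.1
  induction hxy with
  | single hb => exact step x hx _ hb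
  | tail _ hbc ih => exact step _ ih.2 _ hbc

theorem IsTrapping.mem_image_of_chainRecurrent [CompactSpace X] (hc : Continuous h) {U : Set X}
    (hU : IsTrapping h U) {x : X} (hx : ChainRecurrent h x) (hxU : x ∈ U) :
    x ∈ h '' closure U := by
  by_contra hxK
  obtain ⟨δ, hδ, hmem⟩ := hU.exists_forall_epsChain_mem hc isOpen_compl_singleton
    (V := {x}ᶜ) (fun y hy hyx => hxK (mem_singleton_iff.1 hyx ▸ hy))
  exact hmem x hxU x (hx δ hδ) rfl

theorem IsTrapping.mem_of_chainEquiv [CompactSpace X] (hc : Continuous h) {U : Set X}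
    (hU : IsTrapping h U) {x y : X} (hxy : ChainEquiv h x y) (hxU : x ∈ U) : y ∈ U := by
  obtain ⟨δ, hδ, hmem⟩ := hU.exists_forall_epsChain_mem hc hU.isOpen hU.image_subset
  exact hmem x hxU y (hxy.2.2 δ hδ).1

theorem ChainEquiv.symm {x y : X} (hxy : ChainEquiv h x y) : ChainEquiv h y x :=
  ⟨hxy.2.1, hxy.1, fun ε hε => (hxy.2.2 ε hε).symm⟩

theorem isClosed_chainRecurrent (hc : Continuous h) : IsClosed {x | ChainRecurrent h x} := by
  rw [← closure_subset_iff_isClosed]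
  intro x hx ε hε
  have h1 : ∀ᶠ y in 𝓝 x, dist (h x) (h y) < ε / 3 :=
    (continuous_const.dist hc).continuousAt.eventually_lt continuousAt_const
      (by simpa using by linarith)
  have h2 : ∀ᶠ y in 𝓝 x, dist y x < ε / 3 := ball_mem_nhds x (by linarith)
  obtain ⟨y, ⟨hy1, hy2⟩, hrec⟩ := mem_closure_iff_nhds.1 hx _ (h1.and h2)
  have hyy := epsChainFromTo_iff_transGen.1 (hrec (ε / 3) (by linarith))
  rw [epsChainFromTo_iff_transGen]
  obtain ⟨b, hyb, hby⟩ := Relation.TransGen.head'_iff.1 hyy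
  have hxy : Relation.TransGen (fun a b => dist (h a) b < 2 * ε / 3) x y := by
    refine Relation.TransGen.head' (b := b) ?_
      (Relation.ReflTransGen.mono (fun a b (hab : dist (h a) b < ε / 3) => ?_) _ _ hby)
    · linarith [dist_triangle (h x) (h y) b]
    · linarith
  obtain ⟨b', hxb, hb'y⟩ := Relation.TransGen.tail'_iff.1 hxy
  refine Relation.TransGen.tail' (b := b')
    (Relation.ReflTransGen.mono (fun a b (hab : dist (h a) b < 2 * ε / 3) => ?_) _ _ hxb) ?_
  · linarith
  · linarith [dist_triangle (h b') y x]

/-- A function into `[0, 1]` which decreases along orbits, takes only the values `0` and `1` on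
the chain recurrent set, and is constant on chain transitive classes. -/
structure IsChainBarrier (h : X → X) (g : X → ℝ) : Prop where
  mem_Icc : ∀ x, g x ∈ Icc (0 : ℝ) 1
  map_le : ∀ x, g (h x) ≤ g x
  eq_zero_or_one : ∀ x, ChainRecurrent h x → g x = 0 ∨ g x = 1
  eq_of_chainEquiv : ∀ x y, ChainEquiv h x y → g x = g y

theorem IsTrapping.isChainBarrier [CompactSpace X] (hc : Continuous h) {U : Set X}
    (hU : IsTrapping h U) {g : X → ℝ} (hg : ∀ x, g x ∈ Icc (0 : ℝ) 1)
    (h0 : ∀ x, x ∈ h '' closure U → g x = 0) (h1 : ∀ x, x ∉ U → g x = 1) :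
    IsChainBarrier h g where
  mem_Icc := hg
  map_le x := by
    by_cases hx : x ∈ U
    · rw [h0 _ (mem_image_of_mem h (subset_closure hx))]
      exact (hg x).1
    · rw [h1 x hx]
      exact (hg _).2
  eq_zero_or_one x hx := by
    by_cases hxU : x ∈ U
    · exact .inl (h0 x (hU.mem_image_of_chainRecurrent hc hx hxU))
    · exact .inr (h1 x hxU)
  eq_of_chainEquiv x y hxy := by
    by_cases hxU : x ∈ U
    · rw [h0 x (hU.mem_image_of_chainRecurrent hc hxy.1 hxU),
        h0 y (hU.mem_image_of_chainRecurrent hc hxy.2.1 (hU.mem_of_chainEquiv hc hxy hxU))]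
    · rw [h1 x hxU, h1 y fun hyU => hxU (hU.mem_of_chainEquiv hc hxy.symm hyU)]

end Chains

/-! ### Rapidly decreasing weights -/

section Weights

theorem exists_rapidly_decreasing_weights (M : ℕ → ℝ) (hM : ∀ n, 0 ≤ M n) :
    ∃ c : ℕ → ℝ, (∀ n, 0 < c n) ∧ (∀ n, c (n + 1) ≤ c n / 4) ∧
      ∀ n, c n * M n ≤ (1 / 4) ^ n := by
  have hd : ∀ n, 0 < (4 * (1 + M n))⁻¹ := fun n => by have := hM n; positivity
  have hd4 : ∀ n, (4 * (1 + M n))⁻¹ ≤ 1 / 4 := fun n => by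
    rw [one_div]
    exact inv_anti₀ (by norm_num) (by linarith [hM n])
  refine ⟨fun n => ∏ i ∈ Finset.range (n + 1), (4 * (1 + M i))⁻¹,
    fun n => Finset.prod_pos fun i _ => hd i, fun n => ?_, fun n => ?_⟩
  · beta_reduce
    rw [Finset.prod_range_succ _ (n + 1), div_eq_mul_one_div]
    exact mul_le_mul_of_nonneg_left (hd4 _) (Finset.prod_pos fun i _ => hd i).le
  · beta_reduce
    rw [Finset.prod_range_succ, mul_assoc]
    have h1 : ∏ i ∈ Finset.range n, (4 * (1 + M i))⁻¹ ≤ (1 / 4) ^ n := by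
      calc _ ≤ ∏ i ∈ Finset.range n, (1 / 4 : ℝ) :=
            Finset.prod_le_prod (fun i _ => (hd i).le) fun i _ => hd4 i
        _ = _ := by simp
    have h2 : (4 * (1 + M n))⁻¹ * M n ≤ 1 := by
      have := hM n
      rw [inv_mul_le_iff₀ (by positivity)]
      linarith
    calc _ ≤ (1 / 4 : ℝ) ^ n * 1 :=
          mul_le_mul h1 h2 (mul_nonneg (hd n).le (hM n)) (by positivity)
      _ = _ := mul_one _

variable {c : ℕ → ℝ}

theorem le_mul_pow_of_le_div_four (hc4 : ∀ n, c (n + 1) ≤ c n / 4)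
    (n k : ℕ) : c (n + k) ≤ c n * (1 / 4) ^ k := by
  induction k with
  | zero => simp
  | succ k ih =>
    rw [← add_assoc, pow_succ]
    linarith [hc4 (n + k)]

theorem summable_weights_mul (hc : ∀ n, 0 < c n) (hc4 : ∀ n, c (n + 1) ≤ c n / 4)
    {e : ℕ → ℝ} (he : ∀ n, e n ∈ Icc (0 : ℝ) 1) : Summable fun n => c n * e n := by
  refine Summable.of_nonneg_of_le (fun n => mul_nonneg (hc n).le (he n).1) (fun n => ?_)
    ((summable_geometric_of_lt_one (by norm_num : (0 : ℝ) ≤ 1 / 4) (by norm_num)).mul_left (c 0))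
  have := le_mul_pow_of_le_div_four hc4 0 n
  rw [zero_add] at this
  exact (mul_le_of_le_one_right (hc n).le (he n).2).trans this

theorem tsum_weights_tail_le (hc : ∀ n, 0 < c n) (hc4 : ∀ n, c (n + 1) ≤ c n / 4)
    {e : ℕ → ℝ} (he : ∀ n, e n ∈ Icc (0 : ℝ) 1) (n : ℕ) :
    ∑' k, c (k + n) * e (k + n) ≤ 2 * c n := by
  have hgeo := (hasSum_geometric_of_lt_one (by norm_num : (0 : ℝ) ≤ 1 / 4) (by norm_num)).mul_left
    (c n)
  calc ∑' k, c (k + n) * e (k + n) ≤ ∑' k, c n * (1 / 4) ^ k := by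
        refine Summable.tsum_le_tsum (fun k => ?_)
          ((summable_nat_add_iff n).2 (summable_weights_mul hc hc4 he)) hgeo.summable
        have := le_mul_pow_of_le_div_four hc4 n k
        rw [add_comm n k] at this
        exact (mul_le_of_le_one_right (hc _).le (he _).2).trans this
    _ = c n * (1 - 1 / 4)⁻¹ := hgeo.tsum_eq
    _ ≤ 2 * c n := by
        norm_num
        linarith [hc n]

theorem tsum_weights_lt (hc : ∀ n, 0 < c n) (hc4 : ∀ n, c (n + 1) ≤ c n / 4)
    {e e' : ℕ → ℝ} (he : ∀ n, e n ∈ Icc (0 : ℝ) 1) (he' : ∀ n, e' n ∈ Icc (0 : ℝ) 1) (n : ℕ)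
    (hlt : ∀ k < n, e k = e' k) (h0 : e n = 0) (h1 : e' n = 1) :
    ∑' k, c k * e k < ∑' k, c k * e' k := by
  rw [← (summable_weights_mul hc hc4 he).sum_add_tsum_nat_add (n + 1),
    ← (summable_weights_mul hc hc4 he').sum_add_tsum_nat_add (n + 1),
    Finset.sum_range_succ, Finset.sum_range_succ,
    Finset.sum_congr rfl fun k hk => by rw [hlt k (Finset.mem_range.1 hk)], h0, h1]
  have h2 := tsum_weights_tail_le hc hc4 he (n + 1)
  have h3 : 0 ≤ ∑' k, c (k + (n + 1)) * e' (k + (n + 1)) :=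
    tsum_nonneg fun k => mul_nonneg (hc _).le (he' _).1
  linarith [hc n, hc4 n]

theorem tsum_weights_injective (hc : ∀ n, 0 < c n) (hc4 : ∀ n, c (n + 1) ≤ c n / 4)
    {e e' : ℕ → ℝ} (he : ∀ n, e n = 0 ∨ e n = 1) (he' : ∀ n, e' n = 0 ∨ e' n = 1)
    (heq : ∑' k, c k * e k = ∑' k, c k * e' k) : e = e' := by
  classical
  by_contra hne
  have hex : ∃ n, e n ≠ e' n := Function.ne_iff.1 hne
  have hmin : ∀ k < Nat.find hex, e k = e' k := fun k hk => not_not.1 (Nat.find_min hex hk)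
  have hspec := Nat.find_spec hex
  have hI : ∀ f : ℕ → ℝ, (∀ n, f n = 0 ∨ f n = 1) → ∀ n, f n ∈ Icc (0 : ℝ) 1 := by
    intro f hf n
    rcases hf n with h | h <;> simp [h]
  rcases he (Nat.find hex) with h | h <;> rcases he' (Nat.find hex) with h' | h'
  · exact hspec (h.trans h'.symm)
  · exact (tsum_weights_lt hc hc4 (hI e he) (hI e' he') _ hmin h h').ne heq
  · exact (tsum_weights_lt hc hc4 (hI e' he') (hI e he) _ (fun k hk => (hmin k hk).symm)
      h' h).ne' heq
  · exact hspec (h.trans h'.symm)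

theorem volume_tsum_weights_eq_zero (hc : ∀ n, 0 < c n) (hc4 : ∀ n, c (n + 1) ≤ c n / 4) :
    volume {t : ℝ | ∃ e : ℕ → ℝ, (∀ n, e n = 0 ∨ e n = 1) ∧ t = ∑' k, c k * e k} = 0 := by
  classical
  set A := {t : ℝ | ∃ e : ℕ → ℝ, (∀ n, e n = 0 ∨ e n = 1) ∧ t = ∑' k, c k * e k}
  have hcover : ∀ n, A ⊆ ⋃ s ∈ (Finset.range n).powerset,
      Icc (∑ k ∈ s, c k) (∑ k ∈ s, c k + 2 * c n) := by
    rintro n _ ⟨e, he, rfl⟩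
    have hI : ∀ n, e n ∈ Icc (0 : ℝ) 1 := fun n => by rcases he n with h | h <;> simp [h]
    have hsum : ∑ k ∈ Finset.range n with e k = 1, c k = ∑ k ∈ Finset.range n, c k * e k := by
      rw [Finset.sum_filter]
      refine Finset.sum_congr rfl fun k _ => ?_
      rcases he k with h | h <;> simp [h]
    simp only [mem_iUnion, exists_prop]
    refine ⟨{k ∈ Finset.range n | e k = 1}, Finset.mem_powerset.2 (Finset.filter_subset _ _), ?_⟩
    rw [hsum, ← (summable_weights_mul hc hc4 hI).sum_add_tsum_nat_add n]
    have h3 : 0 ≤ ∑' k, c (k + n) * e (k + n) :=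
      tsum_nonneg fun k => mul_nonneg (hc _).le (hI _).1
    exact ⟨by linarith, by linarith [tsum_weights_tail_le hc hc4 hI n]⟩
  have hbound : ∀ n : ℕ, volume A ≤ ENNReal.ofReal (2 * c 0 * (1 / 2) ^ n) := by
    intro n
    calc volume A ≤ ∑ s ∈ (Finset.range n).powerset,
          volume (Icc (∑ k ∈ s, c k) (∑ k ∈ s, c k + 2 * c n)) :=
            (measure_mono (hcover n)).trans (measure_biUnion_finset_le _ _)
      _ = ENNReal.ofReal (2 ^ n * (2 * c n)) := by
          rw [ENNReal.ofReal_mul (by positivity)]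
          simp [ENNReal.ofReal_pow]
      _ ≤ _ := by
          refine ENNReal.ofReal_le_ofReal ?_
          have := le_mul_pow_of_le_div_four hc4 0 n
          rw [zero_add] at this
          calc (2 : ℝ) ^ n * (2 * c n) ≤ 2 ^ n * (2 * (c 0 * (1 / 4) ^ n)) := by gcongr
            _ = 2 * c 0 * (2 * (1 / 4)) ^ n := by rw [mul_pow]; ring
            _ = _ := by norm_num
  have hlim : Tendsto (fun n : ℕ => ENNReal.ofReal (2 * c 0 * (1 / 2) ^ n)) atTop (𝓝 0) := by
    have := (tendsto_pow_atTop_nhds_zero_of_lt_one (by norm_num : (0 : ℝ) ≤ 1 / 2)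
      (by norm_num)).const_mul (2 * c 0)
    simpa using ENNReal.tendsto_ofReal this
  exact le_antisymm (ge_of_tendsto' hlim hbound) zero_le

end Weights

/-! ### Smooth complete Lyapunov functions -/

section Smooth

variable {E : Type*} [NormedAddCommGroup E] [NormedSpace ℝ E]

/-- A sequence of compactly supported smooth functions can be summed to a smooth function, with
weights decreasing as fast as one likes. -/
theorem exists_weights_contDiff_tsum {g : ℕ → E → ℝ}
    (hg : ∀ n, ContDiff ℝ (⊤ : ℕ∞) (g n)) (hsupp : ∀ n, HasCompactSupport (g n)) :
    ∃ c : ℕ → ℝ, (∀ n, 0 < c n) ∧ (∀ n, c (n + 1) ≤ c n / 4) ∧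
      ContDiff ℝ (⊤ : ℕ∞) fun x => ∑' n, c n * g n x := by
  have hB : ∀ n k : ℕ, ∃ B, ∀ x, ‖iteratedFDeriv ℝ k (g n) x‖ ≤ B := fun n k =>
    ((hg n).continuous_iteratedFDeriv (by exact_mod_cast le_top)).bounded_above_of_compact_support
      ((hsupp n).iteratedFDeriv k)
  choose B hB using hB
  have hB0 : ∀ n k, 0 ≤ B n k := fun n k => (norm_nonneg _).trans (hB n k 0)
  obtain ⟨c, hc, hc4, hcM⟩ := exists_rapidly_decreasing_weights
    (fun n => ∑ k ∈ Finset.range (n + 1), B n k) fun n => Finset.sum_nonneg fun k _ => hB0 n k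
  refine ⟨c, hc, hc4, contDiff_tsum_of_eventually (v := fun _ n => (1 / 4) ^ n)
    (fun n => contDiff_const.mul (hg n))
    (fun _ _ => summable_geometric_of_lt_one (by norm_num) (by norm_num)) fun k _ => ?_⟩
  rw [Nat.cofinite_eq_atTop]
  filter_upwards [eventually_ge_atTop k] with n hn x
  have hsmul : iteratedFDeriv ℝ k (fun x => c n * g n x) x = c n • iteratedFDeriv ℝ k (g n) x :=
    iteratedFDeriv_const_smul_apply (a := c n) (((hg n).of_le (by exact_mod_cast le_top)).contDiffAt)
  rw [hsmul, norm_smul, Real.norm_of_nonneg (hc n).le]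
  refine le_trans (mul_le_mul_of_nonneg_left ((hB n k x).trans ?_) (hc n).le) (hcM n)
  exact Finset.single_le_sum (f := fun k => B n k) (fun k _ => hB0 n k)
    (Finset.mem_range.2 (by omega))

variable [FiniteDimensional ℝ E] {S : Set E}

theorem exists_contDiff_compactSupport_eq_zero_iff_eq_one_iff (hS : IsCompact S) {K L : Set S}
    (hK : IsClosed K) (hL : IsClosed L) (hKL : Disjoint K L) :
    ∃ G : E → ℝ, ContDiff ℝ (⊤ : ℕ∞) G ∧ HasCompactSupport G ∧
      (∀ x : S, G x ∈ Icc (0 : ℝ) 1) ∧ (∀ x : S, x ∈ K ↔ G x = 0) ∧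
      ∀ x : S, x ∈ L ↔ G x = 1 := by
  have hcl := hS.isClosed.isClosedEmbedding_subtypeVal
  obtain ⟨f, hf, hfr, hf0, hf1⟩ := exists_contMDiff_zero_iff_one_iff_of_isClosed (n := (⊤ : ℕ∞))
    𝓘(ℝ, E) (hcl.isClosedMap _ hK) (hcl.isClosedMap _ hL)
    ((disjoint_image_iff Subtype.val_injective).2 hKL)
  obtain ⟨R, hR⟩ := hS.isBounded.subset_closedBall (0 : E)
  let χ : ContDiffBump (0 : E) := ⟨max R 1, max R 1 + 1, by positivity, by linarith⟩
  have hχ : ∀ x : S, χ x = 1 := fun x =>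
    χ.one_of_mem_closedBall (closedBall_subset_closedBall (le_max_left R 1) (hR x.2))
  refine ⟨fun x => χ x * f x, χ.contDiff.mul hf.contDiff, χ.hasCompactSupport.mul_right,
    fun x => ?_, fun x => ?_, fun x => ?_⟩
  · simpa [hχ x] using hfr (mem_range_self (x : E))
  · beta_reduce
    rw [hχ x, one_mul, ← hf0, Subtype.val_injective.mem_set_image]
  · beta_reduce
    rw [hχ x, one_mul, ← hf1, Subtype.val_injective.mem_set_image]

theorem IsTrapping.exists_contDiff_isChainBarrier (hS : IsCompact S) {h : S → S}
    (hc : Continuous h) {U : Set S} (hU : IsTrapping h U) :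
    ∃ G : E → ℝ, ContDiff ℝ (⊤ : ℕ∞) G ∧ HasCompactSupport G ∧
      IsChainBarrier h (fun x : S => G x) ∧ (∀ x : S, x ∈ h '' closure U ↔ G x = 0) ∧
      ∀ x : S, x ∉ U ↔ G x = 1 := by
  have : CompactSpace S := isCompact_iff_compactSpace.1 hS
  obtain ⟨G, hG, hsupp, hI, h0, h1⟩ := exists_contDiff_compactSupport_eq_zero_iff_eq_one_iff hS
    (isClosed_closure.isCompact.image hc).isClosed hU.isOpen.isClosed_compl
    (disjoint_compl_right_iff_subset.2 hU.image_subset)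
  exact ⟨G, hG, hsupp, hU.isChainBarrier hc hI (fun x => (h0 x).1) (fun x => (h1 x).1), h0, h1⟩

/-- A continuous self-map of a compact subset of a finite-dimensional space has a complete Lyapunov
function which is the restriction of a smooth function on the ambient space. -/
theorem exists_contDiff_completeLyapunov (hS : IsCompact S) {h : S → S} (hc : Continuous h) :
    ∃ F : E → ℝ, ContDiff ℝ (⊤ : ℕ∞) F ∧
      (∀ x : S, ¬ ChainRecurrent h x → F (h x) < F x) ∧
      (∀ x y : S, ChainRecurrent h x → ChainRecurrent h y →
        (F x = F y ↔ ChainEquiv h x y)) ∧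
      IsClosed ((fun x : S => F x) '' {x | ChainRecurrent h x}) ∧
      volume ((fun x : S => F x) '' {x | ChainRecurrent h x}) = 0 := by
  have : CompactSpace S := isCompact_iff_compactSpace.1 hS
  let 𝒢 : Set (E → ℝ) := {G | ContDiff ℝ (⊤ : ℕ∞) G ∧ HasCompactSupport G ∧
    IsChainBarrier h (fun x : S => G x)}
  have hsep : ∀ (x y : S) (ε : ℝ), 0 < ε → EpsChainFromTo h ε x y → ¬ EpsChainFromTo h ε x x →
      ∃ G ∈ 𝒢, G x ≠ G y := by
    intro x y ε hε hxy hxx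
    obtain ⟨G, hG, hsupp, hbar, -, h1⟩ :=
      (isTrapping_setOf_epsChainFromTo hc hε x).exists_contDiff_isChainBarrier hS hc
    refine ⟨G, ⟨hG, hsupp, hbar⟩, fun heq => ?_⟩
    exact (h1 y).2 (heq ▸ (h1 x).1 hxx) hxy
  have hsep' : ∀ (x y : S) (ε : ℝ), 0 < ε → ChainRecurrent h x → ¬ EpsChainFromTo h ε x y →
      ∃ G ∈ 𝒢, G x ≠ G y := by
    intro x y ε hε hx hxy
    obtain ⟨G, hG, hsupp, hbar, -, h1⟩ :=
      (isTrapping_setOf_epsChainFromTo hc hε x).exists_contDiff_isChainBarrier hS hc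
    refine ⟨G, ⟨hG, hsupp, hbar⟩, fun heq => ?_⟩
    exact (h1 x).2 (heq ▸ (h1 y).1 hxy) (hx ε hε)
  obtain ⟨T, hT𝒢, hTc, hT⟩ := TopologicalSpace.isOpen_biUnion_countable 𝒢
    (fun G => {p : S × S | G p.1 ≠ G p.2}) fun G hG => isOpen_ne_fun
      (hG.1.continuous.comp (continuous_subtype_val.comp continuous_fst))
      (hG.1.continuous.comp (continuous_subtype_val.comp continuous_snd))
  have hTsep : ∀ x y : S, (∃ G ∈ 𝒢, G x ≠ G y) → ∃ G ∈ T, G x ≠ G y := by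
    rintro x y ⟨G, hG, hne⟩
    have hmem : (x, y) ∈ ⋃ G ∈ T, {p : S × S | G p.1 ≠ G p.2} :=
      hT ▸ mem_biUnion hG hne
    simpa using hmem
  obtain ⟨G₀, hG₀⟩ : 𝒢.Nonempty := by
    obtain ⟨G, hG, hsupp, hbar, -⟩ :=
      (IsTrapping.mk isOpen_empty (by simp) : IsTrapping h ∅).exists_contDiff_isChainBarrier hS hc
    exact ⟨G, hG, hsupp, hbar⟩
  obtain ⟨g, hg⟩ := (hTc.insert G₀).exists_eq_range (insert_nonempty G₀ T)
  have hg𝒢 : ∀ n, g n ∈ 𝒢 := by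
    intro n
    have : g n ∈ insert G₀ T := hg ▸ mem_range_self n
    exact insert_subset hG₀ hT𝒢 this
  have hgsep : ∀ x y : S, (∃ G ∈ 𝒢, G x ≠ G y) → ∃ n, g n x ≠ g n y := by
    intro x y hxy
    obtain ⟨G, hG, hne⟩ := hTsep x y hxy
    obtain ⟨n, rfl⟩ : G ∈ range g := hg ▸ mem_insert_of_mem G₀ hG
    exact ⟨n, hne⟩
  have hbar : ∀ n, IsChainBarrier h (fun x : S => g n x) := fun n => (hg𝒢 n).2.2
  obtain ⟨c, hcpos, hc4, hF⟩ :=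
    exists_weights_contDiff_tsum (fun n => (hg𝒢 n).1) (fun n => (hg𝒢 n).2.1)
  have hsum : ∀ x : S, Summable fun n => c n * g n x := fun x =>
    summable_weights_mul hcpos hc4 fun n => (hbar n).mem_Icc x
  refine ⟨fun x => ∑' n, c n * g n x, hF, fun x hx => ?_, fun x y hx hy => ⟨fun heq => ?_,
    fun hxy => ?_⟩, ?_, ?_⟩
  · simp only [ChainRecurrent, not_forall] at hx
    obtain ⟨ε, hε, hx⟩ := hx
    have hstep : EpsChainFromTo h ε x (h x) :=
      epsChainFromTo_iff_transGen.2 (.single (by simpa using hε))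
    obtain ⟨n, hn⟩ := hgsep x (h x) (hsep x (h x) ε hε hstep hx)
    exact Summable.tsum_lt_tsum
      (fun k => mul_le_mul_of_nonneg_left ((hbar k).map_le x) (hcpos k).le)
      (mul_lt_mul_of_pos_left (lt_of_le_of_ne ((hbar n).map_le x) hn.symm) (hcpos n))
      (hsum (h x)) (hsum x)
  · have hbits := tsum_weights_injective hcpos hc4 (fun n => (hbar n).eq_zero_or_one x hx)
      (fun n => (hbar n).eq_zero_or_one y hy) heq
    by_contra hne
    simp only [ChainEquiv, hx, hy, true_and, not_forall, not_and_or] at hne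
    obtain ⟨ε, hε, hxy | hyx⟩ := hne
    · obtain ⟨n, hn⟩ := hgsep x y (hsep' x y ε hε hx hxy)
      exact hn (congrFun hbits n)
    · obtain ⟨n, hn⟩ := hgsep y x (hsep' y x ε hε hy hyx)
      exact hn (congrFun hbits n).symm
  · exact tsum_congr fun n => by rw [(hbar n).eq_of_chainEquiv x y hxy]
  · exact ((isClosed_chainRecurrent hc).isCompact.image
      (hF.continuous.comp continuous_subtype_val)).isClosed
  · refine measure_mono_null ?_ (volume_tsum_weights_eq_zero hcpos hc4)
    rintro _ ⟨x, hx, rfl⟩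
    exact ⟨fun n => g n x, fun n => (hbar n).eq_zero_or_one x hx, rfl⟩

end Smooth

/-- Proposition 3.2 (p1): existence of a `C^∞` complete Lyapunov function. -/
theorem statement4 (h : S2 ≃ₜ S2) (pinf minf : S2) (Winf Wminf : Set S2)
    (hAR : IsNontrivAR h pinf minf Winf Wminf) :
    ∃ H : S2 → ℝ, ContMDiff (𝓡 2) 𝓘(ℝ, ℝ) (⊤ : ℕ∞) H ∧ IsCompleteLyapunov (⇑h) H := by
  have hcont : Continuous ⇑h := h.continuous
  obtain ⟨F, hF, hstrict, heq, hclosed, hnull⟩ :=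
    exists_contDiff_completeLyapunov (isCompact_sphere (0 : EuclideanSpace ℝ (Fin 3)) 1) hcont
  exact ⟨fun x => F x, hF.contMDiff.comp contMDiff_coe_sphere,
    hF.continuous.comp continuous_subtype_val, hstrict, heq, hclosed, hnull⟩
end
end

section
/- Let h be a nontrivial attractor–repellor map of S², let H be a complete Lyapunov function of h, let C₀ be a chain transitive class of h with H(C₀) = {0}, and let −a′ < 0 < a be dynamically regular values of H. Then there exists ε₀ > 0 such that for every ε with 0 < ε < ε₀, every ε-chain of h joining two points of C₀ is entirely contained in H^{−1}((−a′, a)). -/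
noncomputable section

open Metric Set Function Filter MeasureTheory Topology Manifold

section ChainRecurrence

variable {X : Type*} [MetricSpace X] {h : X → X}

/-- The image of a chain recurrent point by a uniformly continuous map is chain recurrent. -/
theorem ChainRecurrent.map (hu : UniformContinuous h) {x : X} (hx : ChainRecurrent h x) :
    ChainRecurrent h (h x) := by
  intro ε hε
  obtain ⟨δ, hδ, hδε⟩ := Metric.uniformContinuous_iff.1 hu ε hε
  obtain ⟨r, z, ⟨hr, hz⟩, h0, h1⟩ := hx δ hδ
  exact ⟨r, fun i => h (z i), ⟨hr, fun i hi => hδε (hz i hi)⟩, congrArg h h0, congrArg h h1⟩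

/-- A chain recurrent point can be reached by `ε`-chains from its image. -/
theorem ChainRecurrent.epsChain_map_self (hu : UniformContinuous h) {x : X}
    (hx : ChainRecurrent h x) {ε : ℝ} (hε : 0 < ε) : EpsChainFromTo h ε (h x) x := by
  obtain ⟨δ, hδ, hδε⟩ := Metric.uniformContinuous_iff.1 hu (ε / 2) (half_pos hε)
  obtain ⟨r, z, ⟨hr, hz⟩, rfl, h1⟩ := hx (min δ (ε / 2)) (lt_min hδ (half_pos hε))
  have hfirst : dist (h (h (z 0))) (h (z 1)) < ε / 2 :=
    hδε ((hz 0 hr).trans_le (min_le_left _ _))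
  have hstep : ∀ i < r, dist (h (z i)) (z (i + 1)) < ε / 2 := fun i hi =>
    (hz i hi).trans_le (min_le_right _ _)
  obtain rfl | hr2 : r = 1 ∨ 2 ≤ r := by omega
  · refine ⟨1, fun i => if i = 0 then h (z 0) else z 0, ⟨le_rfl, fun i hi => ?_⟩, by simp, by simp⟩
    obtain rfl : i = 0 := by omega
    have h2 := hstep 0 zero_lt_one
    rw [zero_add, h1] at h2
    rw [h1] at hfirst
    simpa using (dist_triangle _ _ _).trans_lt (add_lt_add hfirst h2)
  · refine ⟨r - 1, fun i => if i = 0 then h (z 0) else z (i + 1), ⟨by omega, fun i hi => ?_⟩,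
      by simp, ?_⟩
    · obtain rfl | hi0 := Nat.eq_zero_or_pos i
      · simpa using (dist_triangle _ _ _).trans_lt (add_lt_add hfirst (hstep 1 hr2))
      · simpa [hi0.ne'] using (hstep (i + 1) (by omega)).trans (half_lt_self hε)
    · have : r - 1 ≠ 0 := by omega
      simp only [this, if_false]
      rw [Nat.sub_add_cancel hr, h1]

/-- A chain recurrent point is chain transitive to its image. -/
theorem ChainRecurrent.chainEquiv_map (hu : UniformContinuous h) {x : X}
    (hx : ChainRecurrent h x) : ChainEquiv h x (h x) := by
  refine ⟨hx, hx.map hu, fun ε hε => ⟨?_, hx.epsChain_map_self hu hε⟩⟩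
  refine ⟨1, fun i => h^[i] x, ⟨le_rfl, fun i hi => ?_⟩, rfl, rfl⟩
  rwa [← Function.iterate_succ_apply' h i x, dist_self]

end ChainRecurrence

/-- The image of a sublevel set of a dynamically regular value lies in the strict sublevel set. -/
theorem IsCompleteLyapunov.map_lt {h : S2 → S2} {H : S2 → ℝ} (hL : IsCompleteLyapunov h H)
    (hh : Continuous h) {c : ℝ} (hc : c ∉ H '' chainRecSet h) {x : S2} (hx : H x ≤ c) :
    H (h x) < c := by
  have hu : UniformContinuous h := CompactSpace.uniformContinuous_of_continuous hh
  by_cases hr : ChainRecurrent h x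
  · rw [← (hL.2.2.1 x (h x) hr (hr.map hu)).2 (hr.chainEquiv_map hu)]
    exact hx.lt_of_ne fun hxc => hc ⟨x, hr, hxc⟩
  · exact (hL.2.1 x hr).trans_le hx

/-- Sublevel sets of a dynamically regular value trap all sufficiently fine chains. -/
theorem IsCompleteLyapunov.exists_trapping {h : S2 → S2} {H : S2 → ℝ}
    (hL : IsCompleteLyapunov h H) (hh : Continuous h) {c : ℝ} (hc : c ∉ H '' chainRecSet h) :
    ∃ ε₀ > (0 : ℝ), ∀ ε < ε₀, ∀ (r : ℕ) (z : ℕ → S2), IsEpsChain h ε r z →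
      ∀ i j, i < j → j ≤ r → H (z i) ≤ c → H (z j) < c := by
  have hK : IsCompact (h '' {x | H x ≤ c}) :=
    (isClosed_le hL.1 continuous_const).isCompact.image hh
  have hU : IsOpen {x | H x < c} := isOpen_lt hL.1 continuous_const
  have hKU : h '' {x | H x ≤ c} ⊆ {x | H x < c} := by
    rintro _ ⟨x, hx, rfl⟩
    exact hL.map_lt hh hc hx
  obtain ⟨δ, hδ, hsub⟩ := hK.exists_thickening_subset_open hU hKU
  refine ⟨δ, hδ, fun ε hε r z hz i j hij hjr hi => ?_⟩
  have step : ∀ k < r, H (z k) ≤ c → H (z (k + 1)) < c := fun k hk hkc =>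
    hsub (Metric.mem_thickening_iff.2
      ⟨h (z k), ⟨z k, hkc, rfl⟩, by rw [dist_comm]; exact (hz.2 k hk).trans hε⟩)
  induction j, hij using Nat.le_induction with
  | base => exact step i (by omega) hi
  | succ k _ ih => exact step k (by omega) (ih (by omega)).le

/-- Lemma 3.7 (l5): small chains between points of `C₀` stay in `H⁻¹((−a′, a))`. -/
theorem statement6 (h : S2 ≃ₜ S2) (pinf minf : S2) (Winf Wminf : Set S2)
    (hAR : IsNontrivAR h pinf minf Winf Wminf)
    (H : S2 → ℝ) (hLyap : IsCompleteLyapunov (⇑h) H)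
    (C₀ : Set S2) (hC₀ : IsChainClass (⇑h) C₀) (hH0 : H '' C₀ = {0})
    (a' a : ℝ) (ha' : 0 < a') (ha : 0 < a)
    (hdynreg' : -a' ∉ H '' chainRecSet (⇑h)) (hdynreg : a ∉ H '' chainRecSet (⇑h)) :
    ∃ ε₀ > (0 : ℝ), ∀ ε : ℝ, 0 < ε → ε < ε₀ → ∀ (r : ℕ) (z : ℕ → S2),
      IsEpsChain (⇑h) ε r z → z 0 ∈ C₀ → z r ∈ C₀ →
      ∀ i ≤ r, H (z i) ∈ Set.Ioo (-a') a := by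
  obtain ⟨ε₁, hε₁, trap⟩ := hLyap.exists_trapping h.continuous hdynreg
  obtain ⟨ε₂, hε₂, trap'⟩ := hLyap.exists_trapping h.continuous hdynreg'
  refine ⟨min ε₁ ε₂, lt_min hε₁ hε₂, fun ε _ hε r z hz hz0 hzr i hi => ?_⟩
  have hC : ∀ x ∈ C₀, H x = 0 := fun x hx => by
    have hx' : H x ∈ H '' C₀ := ⟨x, hx, rfl⟩
    rwa [hH0] at hx'
  have h0 := hC _ hz0
  have hr := hC _ hzr
  constructor
  · by_contra! hlow
    obtain rfl | hir := hi.eq_or_lt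
    · linarith
    · linarith [trap' ε (hε.trans_le (min_le_right _ _)) r z hz i r hir le_rfl hlow]
  · obtain rfl | hi0 := Nat.eq_zero_or_pos i
    · rwa [h0]
    · exact trap ε (hε.trans_le (min_le_left _ _)) r z hz 0 i hi0 hi (by linarith)
end
end

section
/- Let h be an orientation- and end-preserving homeomorphism of the open annulus 𝔸 = S¹ × ℝ with lift h̃. Let D₀, D₁, …, D_{n−1} be closed topological discs in 𝔸 (compact sets homeomorphic to the closed unit 2-disc) such that h(D_{j}) ⊂ Int(D_{j+1 mod n}) for every 0 ≤ j ≤ n−1. If z₁ and z₂ are periodic points of h contained in ⋃_{j=0}^{n−1} D_j, then rot(h̃, z₁) = rot(h̃, z₂). -/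
noncomputable section

open Metric Set Function Filter MeasureTheory Topology Manifold

/-- A continuous map out of a contractible space lifts through a surjective covering map. -/
theorem IsCoveringMap.exists_lift_of_contractible {E X A : Type*} [TopologicalSpace E]
    [TopologicalSpace X] [TopologicalSpace A] [ContractibleSpace A] {p : E → X}
    (cov : IsCoveringMap p) (hp : Surjective p) (f : C(A, X)) : ∃ F : C(A, E), p ∘ F = f := by
  obtain ⟨y, hy⟩ := id_nullhomotopic A
  obtain ⟨G⟩ := hy.symm
  obtain ⟨e, he⟩ := hp (f y)
  let H : C(unitInterval × A, X) := f.comp G.toContinuousMap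
  have H_0 : ∀ a, H (0, a) = p (ContinuousMap.const A e a) := fun a => by
    simp [H, he]
  refine ⟨(cov.liftHomotopy H (ContinuousMap.const A e) H_0).comp
    ((ContinuousMap.const A 1).prodMk (ContinuousMap.id A)), funext fun a => ?_⟩
  have := congrFun (cov.liftHomotopy_lifts H (ContinuousMap.const A e) H_0) (1, a)
  simpa [H] using this

/-- The angular coordinate has a continuous real-valued branch on a contractible set. -/
theorem exists_angle_branch {K : Set Ann} [ContractibleSpace K] :
    ∃ u : Ann → ℝ, ContinuousOn u K ∧ ∀ z ∈ K, (u z : Circle1) = z.1 := by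
  classical
  obtain ⟨F, hF⟩ := (AddCircle.isCoveringMap_coe (1 : ℝ)).exists_lift_of_contractible
    QuotientAddGroup.mk_surjective
    (⟨fun z : K => z.1.1, by fun_prop⟩ : C(K, Circle1))
  refine ⟨fun z => if hz : z ∈ K then F ⟨z, hz⟩ else 0, ?_, fun z hz => ?_⟩
  · rw [continuousOn_iff_continuous_domRestrict]
    convert F.continuous using 1
    ext z
    simp
  · simpa [hz] using congrFun hF ⟨z, hz⟩

/-- A lift displaces points of a connected set, measured with respect to branches of the angle, by
`φ` up to a constant. -/
theorem exists_displacement_eq_add_const {h : Ann → Ann} {ht : ℝ × ℝ → ℝ × ℝ} {φ : Ann → ℝ}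
    (hh : Continuous h) (hlift : IsAnnulusLift h ht) (hφ : DescendsTo ht φ) {K L : Set Ann}
    (hK : IsPreconnected K) (hKL : MapsTo h K L) {u v : Ann → ℝ}
    (hu : ContinuousOn u K) (hu' : ∀ z ∈ K, (u z : Circle1) = z.1)
    (hv : ContinuousOn v L) (hv' : ∀ z ∈ L, (v z : Circle1) = z.1) :
    ∃ c : ℝ, ∀ z ∈ K, φ z = v (h z) - u z + c := by
  rcases K.eq_empty_or_nonempty with rfl | ⟨w, hw⟩
  · exact ⟨0, by simp⟩
  have hcont : ContinuousOn (fun z => φ z - (v (h z) - u z)) K :=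
    hφ.1.continuousOn.sub ((hv.comp hh.continuousOn hKL).sub hu)
  have hmaps : MapsTo (fun z => φ z - (v (h z) - u z)) K (range ((↑) : ℤ → ℝ)) := by
    intro z hz
    have hz' : annP (u z, z.2) = z := Prod.ext (hu' z hz) rfl
    have hφz : φ z = (ht (u z, z.2)).1 - u z := by simpa [hz'] using hφ.2 (u z, z.2)
    have hlz : (((ht (u z, z.2)).1 : ℝ) : Circle1) = (v (h z) : Circle1) := by
      rw [hv' _ (hKL hz)]
      have := congrArg Prod.fst (hlift.2 (u z, z.2))
      rwa [hz'] at this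
    rw [← sub_eq_zero, ← AddCircle.coe_sub, AddCircle.coe_eq_zero_iff] at hlz
    obtain ⟨k, hk⟩ := hlz
    refine ⟨k, ?_⟩
    dsimp only
    rw [zsmul_one] at hk
    rw [hφz, hk]
    ring
  have hdisc : IsDiscrete (range ((↑) : ℤ → ℝ)) :=
    ⟨Int.isClosedEmbedding_coe_real.isEmbedding.toHomeomorph.symm.isEmbedding.discreteTopology⟩
  refine ⟨φ w - (v (h w) - u w), fun z hz => ?_⟩
  have := hK.constant_of_mapsTo hdisc hcont hmaps hz hw
  linarith

/-- Along a periodic orbit, Birkhoff sums over a multiple of the period are multiples of the sum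
over one period. -/
theorem sum_range_mul_of_iterate_eq {X : Type*} {h : X → X} {q : ℕ} {z : X} (hz : h^[q] z = z)
    (φ : X → ℝ) (m : ℕ) :
    ∑ i ∈ Finset.range (m * q), φ (h^[i] z) = m * ∑ i ∈ Finset.range q, φ (h^[i] z) := by
  induction m with
  | zero => simp
  | succ m ih =>
    have hm : h^[m * q] z = z := by
      rw [mul_comm, iterate_mul]
      exact iterate_fixed hz m
    rw [add_mul, one_mul, Finset.sum_range_add, ih]
    have : ∀ i, h^[m * q + i] z = h^[i] z := fun i => by
      rw [add_comm, iterate_add_apply, hm]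
    simp only [this]
    push_cast
    ring

/-- In a cycle of sets on which `φ` is cohomologous to constants `c j`, every periodic point has
rotation number the mean of the `c j`. -/
theorem rotPer_eq_mean {h : Ann → Ann} {φ : Ann → ℝ} {n : ℕ} [NeZero n] {D : Fin n → Set Ann}
    (hD : ∀ j, MapsTo h (D j) (D (j + 1))) {u : Fin n → Ann → ℝ} {c : Fin n → ℝ}
    (hc : ∀ j, ∀ z ∈ D j, φ z = u (j + 1) (h z) - u j z + c j)
    {z : Ann} {q : ℕ} (hq : 1 ≤ q) (hper : h^[q] z = z) (hz : z ∈ ⋃ j, D j) :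
    rotPer h φ q z = (∑ j, c j) / n := by
  open Fin.NatCast in
  obtain ⟨j, hj⟩ := mem_iUnion.1 hz
  have hmem : ∀ i : ℕ, h^[i] z ∈ D (j + (i : Fin n)) := by
    intro i
    induction i with
    | zero => simpa using hj
    | succ i ih =>
      rw [iterate_succ_apply', Nat.cast_succ, ← add_assoc]
      exact hD _ ih
  have hsum : ∀ m : ℕ, ∑ i ∈ Finset.range m, φ (h^[i] z) =
      u (j + (m : Fin n)) (h^[m] z) - u j z + ∑ i ∈ Finset.range m, c (j + (i : Fin n)) := by
    intro m
    induction m with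
    | zero => simp
    | succ m ih =>
      rw [Finset.sum_range_succ, Finset.sum_range_succ, ih, hc _ _ (hmem m),
        iterate_succ_apply', Nat.cast_succ, ← add_assoc j]
      ring
  have hcyc : ∀ m : ℕ, ∑ i ∈ Finset.range (m * n), c (j + (i : Fin n)) = m * ∑ k, c k := by
    intro m
    induction m with
    | zero => simp
    | succ m ih =>
      rw [add_mul, one_mul, Finset.sum_range_add, ih]
      have : ∑ i ∈ Finset.range n, c (j + ((m * n + i : ℕ) : Fin n)) = ∑ k, c k := by
        rw [← Fin.sum_univ_eq_sum_range (fun i => c (j + ((m * n + i : ℕ) : Fin n))) n]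
        have hmn : ((m * n : ℕ) : Fin n) = 0 := by simp
        simpa [Nat.cast_add, hmn, -Nat.cast_mul] using Equiv.sum_comp (Equiv.addLeft j) c
      rw [this]
      push_cast
      ring
  have hperiod : h^[q * n] z = z := by
    rw [iterate_mul]
    exact iterate_fixed hper n
  have key := hsum (q * n)
  have hqn : ((q * n : ℕ) : Fin n) = 0 := by simp
  rw [hperiod, hqn, add_zero, sub_self, zero_add, hcyc, mul_comm q n,
    sum_range_mul_of_iterate_eq hper] at key
  have hn : (n : ℝ) ≠ 0 := Nat.cast_ne_zero.2 (NeZero.ne n)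
  have hq' : (q : ℝ) ≠ 0 := Nat.cast_ne_zero.2 (by omega)
  rw [rotPer, div_eq_div_iff hq' hn]
  linarith

/-- Lemma 3.10 (l4): periodic points trapped in a cycle of discs have the same
rotation number. -/
theorem statement7 (h : Ann ≃ₜ Ann) (hor : OrientEndPreserving h)
    (ht : ℝ × ℝ → ℝ × ℝ) (hlift : IsAnnulusLift (⇑h) ht)
    (φ : Ann → ℝ) (hφ : DescendsTo ht φ)
    (n : ℕ) [NeZero n] (D : Fin n → Set Ann)
    (hDcpt : ∀ j, IsCompact (D j))
    (hDdisc : ∀ j, Nonempty (↥(D j) ≃ₜ ↥(Metric.closedBall (0 : EuclideanSpace ℝ (Fin 2)) 1)))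
    (hDmap : ∀ j : Fin n, ⇑h '' D j ⊆ interior (D (j + 1)))
    (z₁ z₂ : Ann) (q₁ q₂ : ℕ) (hq₁ : 1 ≤ q₁) (hq₂ : 1 ≤ q₂)
    (hper₁ : (⇑h)^[q₁] z₁ = z₁) (hper₂ : (⇑h)^[q₂] z₂ = z₂)
    (hz₁ : z₁ ∈ ⋃ j, D j) (hz₂ : z₂ ∈ ⋃ j, D j) :
    rotPer (⇑h) φ q₁ z₁ = rotPer (⇑h) φ q₂ z₂ := by
  have hcontr : ∀ j, ContractibleSpace (D j) := fun j => by
    have : ContractibleSpace (Metric.closedBall (0 : EuclideanSpace ℝ (Fin 2)) 1) :=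
      (convex_closedBall _ _).contractibleSpace ⟨0, by simp⟩
    exact (hDdisc j).some.contractibleSpace
  have hmaps : ∀ j, MapsTo h (D j) (D (j + 1)) := fun j =>
    mapsTo_iff_image_subset.2 ((hDmap j).trans interior_subset)
  choose u hu hu' using fun j => exists_angle_branch (K := D j)
  choose c hc using fun j => exists_displacement_eq_add_const h.continuous hlift hφ
    (isPreconnected_iff_preconnectedSpace.2 inferInstance) (hmaps j)
    (hu j) (hu' j) (hu (j + 1)) (hu' (j + 1))
  rw [rotPer_eq_mean hmaps hc hq₁ hper₁ hz₁, rotPer_eq_mean hmaps hc hq₂ hper₂ hz₂]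
end
end

section
/- Let T : X → X be an ergodic invertible measure-preserving transformation of a probability space (X, μ), and let φ : X → ℝ be an integrable function with ∫ φ dμ = 0. Set S(n, x) = Σ_{i=0}^{n−1} φ(T^i(x)). Then for every ε > 0, the set of points x ∈ X such that |S(n, x)| < ε for infinitely many n ∈ ℕ has full μ-measure. -/
noncomputable section

open MeasureTheory

open Filter Topology

theorem memLp_birkhoffSum {X : Type*} [MeasurableSpace X] {μ : Measure X} {T : X → X}
    (hT : MeasurePreserving T μ μ) {p : ENNReal} {ψ : X → ℝ} (hψ : MemLp ψ p μ) (n : ℕ) :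
    MemLp (birkhoffSum T ψ n) p μ :=
  memLp_finsetSum (Finset.range n) (f := fun k x => ψ (T^[k] x))
    fun k _ => hψ.comp_measurePreserving (hT.iterate k)

theorem birkhoffSum_toLp {X : Type*} [MeasurableSpace X] {μ : Measure X} {T : X → X}
    (hT : MeasurePreserving T μ μ) {p : ENNReal} {ψ : X → ℝ} (hψ : MemLp ψ p μ) (n : ℕ) :
    birkhoffSum (Lp.compMeasurePreserving T hT) id n (hψ.toLp ψ) =
      (memLp_birkhoffSum hT hψ n).toLp _ := by
  have hiter (k : ℕ) : (Lp.compMeasurePreserving T hT)^[k] (hψ.toLp ψ) =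
      (hψ.comp_measurePreserving (hT.iterate k)).toLp _ := by
    induction k with
    | zero => rfl
    | succ k ih =>
      rw [Function.iterate_succ_apply', ih, Lp.toLp_compMeasurePreserving]
      rfl
  induction n with
  | zero => simp [MemLp.toLp_zero]
  | succ n ih =>
    rw [birkhoffSum_succ, ih, id, hiter, ← MemLp.toLp_add]
    exact MemLp.toLp_congr _ _ (.of_forall fun x => (birkhoffSum_succ T ψ n x).symm)

theorem integral_abs_eq_toReal_eLpNorm {X : Type*} [MeasurableSpace X] {μ : Measure X}
    {f : X → ℝ} (hf : AEStronglyMeasurable f μ) : ∫ x, |f x| ∂μ = (eLpNorm f 1 μ).toReal := by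
  rw [eLpNorm_one_eq_lintegral_enorm, ← integral_norm_eq_lintegral_enorm hf]
  simp

theorem integral_abs_le_norm_toLp {X : Type*} [MeasurableSpace X] {μ : Measure X}
    [IsProbabilityMeasure μ] {ψ : X → ℝ} (hψ : MemLp ψ 2 μ) :
    ∫ x, |ψ x| ∂μ ≤ ‖hψ.toLp ψ‖ := by
  rw [Lp.norm_toLp, integral_abs_eq_toReal_eLpNorm hψ.1]
  exact ENNReal.toReal_mono hψ.2.ne (eLpNorm_le_eLpNorm_of_exponent_le (by norm_num) hψ.1)

theorem Ergodic.tendsto_integral_abs_birkhoffSum_div_of_memLp_two {X : Type*} [MeasurableSpace X]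
    {μ : Measure X} [IsProbabilityMeasure μ] {T : X → X} (hT : Ergodic T μ) {ψ : X → ℝ}
    (hψ : MemLp ψ 2 μ) (hmean : ∫ x, ψ x ∂μ = 0) :
    Tendsto (fun n : ℕ => (∫ x, |birkhoffSum T ψ n x| ∂μ) / n) atTop (𝓝 0) := by
  have hmp := hT.toMeasurePreserving
  let U : Lp ℝ 2 μ →L[ℝ] Lp ℝ 2 μ :=
    (Lp.compMeasurePreservingₗᵢ ℝ T hmp).toContinuousLinearMap
  have hU : ‖U‖ ≤ 1 := LinearIsometry.norm_toContinuousLinearMap_le _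
  have hproj : (U.eqLocus (1 : Lp ℝ 2 μ →L[ℝ] Lp ℝ 2 μ)).orthogonalProjectionOnto
      (hψ.toLp ψ) = 0 := by
    rw [Submodule.orthogonalProjectionOnto_eq_zero_iff, Submodule.mem_orthogonal]
    intro g hg
    have hUg : U g = g := by simpa using hg
    have hg' : Lp.compMeasurePreserving T hmp g = g := hUg
    obtain ⟨c, hc⟩ := hT.ae_eq_const_of_ae_eq_comp_ae (Lp.aestronglyMeasurable g)
      ((Lp.coeFn_compMeasurePreserving g hmp).symm.trans (by rw [hg']))
    rw [L2.inner_def]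
    calc ∫ x, inner ℝ (g x) (hψ.toLp ψ x) ∂μ = ∫ x, c * ψ x ∂μ := by
          refine integral_congr_ae ?_
          filter_upwards [hc, hψ.coeFn_toLp] with x h1 h2
          simp [h1, h2, mul_comm]
      _ = 0 := by rw [integral_const_mul, hmean, mul_zero]
  have hlim := (U.tendsto_birkhoffAverage_orthogonalProjection hU (hψ.toLp ψ)).norm
  rw [hproj, Submodule.coe_zero, norm_zero] at hlim
  refine squeeze_zero (fun n => by positivity) (fun n => ?_) hlim
  have hsum : birkhoffSum U id n (hψ.toLp ψ) = (memLp_birkhoffSum hmp hψ n).toLp _ :=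
    birkhoffSum_toLp hmp hψ n
  rw [birkhoffAverage, hsum, norm_smul, norm_inv, RCLike.norm_natCast, div_eq_inv_mul]
  gcongr
  exact integral_abs_le_norm_toLp _

theorem integral_abs_birkhoffSum_le {X : Type*} [MeasurableSpace X] {μ : Measure X} {T : X → X}
    (hT : MeasurePreserving T μ μ) {f : X → ℝ} (hf : Integrable f μ) (n : ℕ) :
    ∫ x, |birkhoffSum T f n x| ∂μ ≤ n * ∫ x, |f x| ∂μ := by
  have hint (k : ℕ) : Integrable (fun x => |f (T^[k] x)|) μ :=
    ((hT.iterate k).integrable_comp_of_integrable hf).abs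
  calc ∫ x, |birkhoffSum T f n x| ∂μ
      ≤ ∫ x, ∑ k ∈ Finset.range n, |f (T^[k] x)| ∂μ :=
        integral_mono_of_nonneg (.of_forall fun x => abs_nonneg _)
          (integrable_finsetSum _ fun k _ => hint k)
          (.of_forall fun x => Finset.abs_sum_le_sum_abs _ _)
    _ = ∑ k ∈ Finset.range n, ∫ x, |f x| ∂μ := by
        rw [integral_finsetSum _ fun k _ => hint k]
        refine Finset.sum_congr rfl fun k _ => ?_
        have hk := hT.iterate k
        conv_rhs => rw [← hk.map_eq]
        exact (integral_map hk.aemeasurable (by rw [hk.map_eq]; exact hf.abs.1)).symm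
    _ = n * ∫ x, |f x| ∂μ := by simp

/-- The `L¹` mean ergodic theorem for an ergodic map and a function of zero mean. -/
theorem Ergodic.tendsto_integral_abs_birkhoffSum_div {X : Type*} [MeasurableSpace X]
    {μ : Measure X} [IsProbabilityMeasure μ] {T : X → X} (hT : Ergodic T μ) {φ : X → ℝ}
    (hφ : Integrable φ μ) (hmean : ∫ x, φ x ∂μ = 0) :
    Tendsto (fun n : ℕ => (∫ x, |birkhoffSum T φ n x| ∂μ) / n) atTop (𝓝 0) := by
  have hmp := hT.toMeasurePreserving
  have hint {f : X → ℝ} (hf : Integrable f μ) (n : ℕ) : Integrable (birkhoffSum T f n) μ :=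
    memLp_one_iff_integrable.1 (memLp_birkhoffSum hmp (memLp_one_iff_integrable.2 hf) n)
  refine tendsto_order.2 ⟨fun a ha => .of_forall fun n => ha.trans_le (by positivity),
    fun η hη => ?_⟩
  obtain ⟨g, hg, -⟩ := (memLp_one_iff_integrable.2 hφ).exists_simpleFunc_eLpNorm_sub_lt
    ENNReal.one_ne_top (ε := ENNReal.ofReal (η / 3)) (by simpa using hη)
  have hgi : Integrable g μ := g.integrable_of_isFiniteMeasure
  have hd : ∫ x, |φ x - g x| ∂μ < η / 3 := by
    rw [integral_abs_eq_toReal_eLpNorm (f := fun x => φ x - g x) (hφ.sub hgi).1]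
    exact (ENNReal.lt_ofReal_iff_toReal_lt hg.ne_top).1 hg
  set c := ∫ x, g x ∂μ with hc
  have hcle : |c| ≤ ∫ x, |φ x - g x| ∂μ := by
    have h := abs_integral_le_integral_abs (f := fun x => φ x - g x) (μ := μ)
    rwa [integral_sub hφ hgi, hmean, zero_sub, abs_neg] at h
  let ψ : X → ℝ := fun x => g x - c
  have hψ : MemLp ψ 2 μ := (g.memLp_of_isFiniteMeasure 2 μ).sub (memLp_const c)
  have hψi : Integrable ψ μ := hgi.sub (integrable_const c)
  have hψ0 : ∫ x, ψ x ∂μ = 0 := by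
    simp [ψ, integral_sub hgi (integrable_const c), ← hc]
  have hdist : ∫ x, |(φ - ψ) x| ∂μ ≤ 2 * (η / 3) := by
    calc ∫ x, |(φ - ψ) x| ∂μ ≤ ∫ x, (|φ x - g x| + |c|) ∂μ := by
          refine integral_mono (hφ.sub hψi).abs ((hφ.sub hgi).abs.add (integrable_const _))
            fun x => ?_
          have h : (φ - ψ) x = (φ x - g x) + c := by simp [ψ]; ring
          simp only [h]
          exact abs_add_le _ _
      _ = ∫ x, |φ x - g x| ∂μ + |c| := by
          rw [integral_add (f := fun x => |φ x - g x|) (hφ.sub hgi).abs (integrable_const _)]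
          simp
      _ ≤ 2 * (η / 3) := by linarith
  filter_upwards [(hT.tendsto_integral_abs_birkhoffSum_div_of_memLp_two hψ hψ0).eventually
    (gt_mem_nhds (show (0 : ℝ) < η / 3 by positivity)), eventually_gt_atTop 0] with n hn hpos
  have hpos' : (0 : ℝ) < n := by exact_mod_cast hpos
  rw [div_lt_iff₀ hpos'] at hn ⊢
  calc ∫ x, |birkhoffSum T φ n x| ∂μ
      ≤ ∫ x, (|birkhoffSum T ψ n x| + |birkhoffSum T (φ - ψ) n x|) ∂μ := by
        refine integral_mono (hint hφ n).abs
          ((hint hψi n).abs.add (hint (hφ.sub hψi) n).abs) fun x => ?_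
        have h : birkhoffSum T φ n x = birkhoffSum T ψ n x + birkhoffSum T (φ - ψ) n x := by
          simp [birkhoffSum_sub]
        simp only [h]
        exact abs_add_le _ _
    _ = ∫ x, |birkhoffSum T ψ n x| ∂μ + ∫ x, |birkhoffSum T (φ - ψ) n x| ∂μ :=
        integral_add (hint hψi n).abs (hint (hφ.sub hψi) n).abs
    _ ≤ ∫ x, |birkhoffSum T ψ n x| ∂μ + n * (2 * (η / 3)) := by
        gcongr
        exact (integral_abs_birkhoffSum_le hmp (hφ.sub hψi) n).trans (by gcongr)
    _ < η * n := by linarith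

/-- Among the times at which the orbit of `x` visits the set of points whose Birkhoff sums have
size at least `ε` from time `N` on, at most `N` have Birkhoff sums of `x` in a given half-open
interval of length `ε`; hence a bound on the number of such times with Birkhoff sums of size at
most `R`. -/
theorem card_visits_le {X : Type*} (T : X → X) (φ : X → ℝ) {ε : ℝ} (hε : 0 < ε) (N : ℕ)
    {R : ℝ} (hR : 0 ≤ R) (x : X) (s : Finset ℕ)
    (hs : ∀ k ∈ s, (∀ m ≥ N, ε ≤ |birkhoffSum T φ m (T^[k] x)|) ∧ |birkhoffSum T φ k x| ≤ R) :
    (s.card : ℝ) ≤ N * (2 * (R / ε) + 2) := by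
  have hmaps : ∀ k ∈ s, ⌊birkhoffSum T φ k x / ε⌋ ∈ Finset.Icc ⌊-(R / ε)⌋ ⌊R / ε⌋ := by
    intro k hk
    obtain ⟨h1, h2⟩ := abs_le.1 (hs k hk).2
    rw [Finset.mem_Icc]
    refine ⟨Int.floor_le_floor ?_, Int.floor_le_floor (by gcongr)⟩
    rw [← neg_div]
    gcongr
  have hfib : ∀ b ∈ Finset.Icc ⌊-(R / ε)⌋ ⌊R / ε⌋,
      (s.filter fun k => ⌊birkhoffSum T φ k x / ε⌋ = b).card ≤ N := by
    intro b _
    set t := s.filter fun k => ⌊birkhoffSum T φ k x / ε⌋ = b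
    rcases t.eq_empty_or_nonempty with h | h
    · simp [h]
    have hsub : t ⊆ Finset.Ico (t.min' h) (t.min' h + N) := by
      intro k hk
      have hmin := t.min'_le k hk
      refine Finset.mem_Ico.2 ⟨hmin, ?_⟩
      by_contra! hlt
      obtain ⟨m, hm⟩ := Nat.exists_eq_add_of_le hmin
      have h0 := Finset.mem_filter.1 (t.min'_mem h)
      have h1 := (hs _ h0.1).1 m (by omega)
      have h2 := Int.abs_sub_lt_one_of_floor_eq_floor
        ((Finset.mem_filter.1 hk).2.trans h0.2.symm)
      rw [hm, birkhoffSum_add, ← sub_div, add_sub_cancel_left, abs_div, abs_of_pos hε,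
        div_lt_one hε] at h2
      exact absurd h2 h1.not_gt
    simpa using Finset.card_le_card hsub
  have hcard := Finset.card_le_mul_card_image_of_maps_to hmaps N hfib
  have hIcc : ((Finset.Icc ⌊-(R / ε)⌋ ⌊R / ε⌋).card : ℝ) ≤ 2 * (R / ε) + 2 := by
    have h0 : (0 : ℝ) ≤ R / ε := by positivity
    have h1 : ⌊-(R / ε)⌋ ≤ ⌊R / ε⌋ := Int.floor_le_floor (by linarith)
    have h2 : ((Finset.Icc ⌊-(R / ε)⌋ ⌊R / ε⌋).card : ℤ) = ⌊R / ε⌋ + 1 - ⌊-(R / ε)⌋ := by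
      rw [Int.card_Icc, Int.toNat_of_nonneg (by omega)]
    have h3 : ((Finset.Icc ⌊-(R / ε)⌋ ⌊R / ε⌋).card : ℝ) = ⌊R / ε⌋ + 1 - ⌊-(R / ε)⌋ := by
      exact_mod_cast h2
    rw [h3]
    linarith [Int.floor_le (R / ε), Int.lt_floor_add_one (-(R / ε))]
  calc (s.card : ℝ) ≤ N * (Finset.Icc ⌊-(R / ε)⌋ ⌊R / ε⌋).card := by exact_mod_cast hcard
    _ ≤ _ := by gcongr

theorem sum_indicator_visits_le {X : Type*} (T : X → X) (φ : X → ℝ) {ε : ℝ} (hε : 0 < ε)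
    (N n : ℕ) {R : ℝ} (hR : 0 < R) (x : X) :
    ∑ k ∈ Finset.range n,
        {y | ∀ m ≥ N, ε ≤ |birkhoffSum T φ m y|}.indicator (fun _ => (1 : ℝ)) (T^[k] x) ≤
      N * (2 * (R / ε) + 2) + ∑ k ∈ Finset.range n, |birkhoffSum T φ k x| / R := by
  classical
  set B := {y | ∀ m ≥ N, ε ≤ |birkhoffSum T φ m y|}
  set s := (Finset.range n).filter fun k => T^[k] x ∈ B ∧ |birkhoffSum T φ k x| ≤ R
  have hcard : (s.card : ℝ) ≤ N * (2 * (R / ε) + 2) :=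
    card_visits_le T φ hε N hR.le x s fun k hk => (Finset.mem_filter.1 hk).2
  have hsum : (s.card : ℝ) = ∑ k ∈ Finset.range n,
      if T^[k] x ∈ B ∧ |birkhoffSum T φ k x| ≤ R then (1 : ℝ) else 0 := by
    rw [Finset.sum_boole]
  refine le_trans ?_ (add_le_add_left hcard _)
  rw [hsum, ← Finset.sum_add_distrib]
  refine Finset.sum_le_sum fun k _ => ?_
  have h0 : 0 ≤ |birkhoffSum T φ k x| / R := by positivity
  by_cases h1 : T^[k] x ∈ B
  · by_cases h2 : |birkhoffSum T φ k x| ≤ R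
    · simp [h1, h2, h0]
    · simpa [h1, h2] using (one_le_div hR).2 (not_le.1 h2).le
  · simpa [h1] using h0

theorem Ergodic.measure_forall_le_abs_birkhoffSum_eq_zero {X : Type*} [MeasurableSpace X]
    {μ : Measure X} [IsProbabilityMeasure μ] {T : X → X} (hT : Ergodic T μ) {φ : X → ℝ}
    (hφm : Measurable φ) (hφ : Integrable φ μ) (hmean : ∫ x, φ x ∂μ = 0) {ε : ℝ} (hε : 0 < ε)
    (N : ℕ) : μ {x | ∀ m ≥ N, ε ≤ |birkhoffSum T φ m x|} = 0 := by
  have hmp := hT.toMeasurePreserving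
  have hSm (n : ℕ) : Measurable (birkhoffSum T φ n) :=
    Finset.measurable_fun_sum _ fun k _ => hφm.comp (hT.measurable.iterate k)
  have hSi (n : ℕ) : Integrable (birkhoffSum T φ n) μ :=
    memLp_one_iff_integrable.1 (memLp_birkhoffSum hmp (memLp_one_iff_integrable.2 hφ) n)
  set B := {x | ∀ m ≥ N, ε ≤ |birkhoffSum T φ m x|} with hB
  have hBm : MeasurableSet B := by
    simp only [hB, Set.ofPred_forall]
    exact .iInter fun m => .iInter fun _ => measurableSet_le measurable_const (hSm m).abs
  let a : ℕ → ℝ := fun n => (∫ x, |birkhoffSum T φ n x| ∂μ) / n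
  have ha : Tendsto a atTop (𝓝 0) := hT.tendsto_integral_abs_birkhoffSum_div hφ hmean
  have ha0 (k : ℕ) : 0 ≤ a k := by positivity
  have hbound {δ : ℝ} (hδ : 0 < δ) {n : ℕ} (hn : 0 < n) :
      μ.real B ≤ N * (2 * (δ / ε) + 2 * (n : ℝ)⁻¹) +
        δ⁻¹ * ((n : ℝ)⁻¹ * ∑ k ∈ Finset.range n, a k) := by
    have hn' : (0 : ℝ) < n := by exact_mod_cast hn
    have hR : 0 < δ * n := by positivity
    have hki (k : ℕ) : Integrable (fun x => B.indicator (fun _ => (1 : ℝ)) (T^[k] x)) μ :=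
      (hmp.iterate k).integrable_comp_of_integrable ((integrable_const _).indicator hBm)
    have hli (k : ℕ) : Integrable (fun x => |birkhoffSum T φ k x| / (δ * n)) μ :=
      (hSi k).abs.div_const _
    have h := integral_mono (integrable_finsetSum (Finset.range n) fun k _ => hki k)
      ((integrable_const (N * (2 * (δ * n / ε) + 2))).add
        (integrable_finsetSum (Finset.range n) fun k _ => hli k))
      (fun x => sum_indicator_visits_le T φ hε N n hR x)
    have hleft (k : ℕ) : ∫ x, B.indicator (fun _ => (1 : ℝ)) (T^[k] x) ∂μ = μ.real B := by
      have : (fun x => B.indicator (fun _ => (1 : ℝ)) (T^[k] x)) =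
        (T^[k] ⁻¹' B).indicator 1 := rfl
      rw [this, integral_indicator_one ((hmp.iterate k).measurable hBm),
        (hmp.iterate k).measureReal_preimage hBm.nullMeasurableSet]
    have hright (k : ℕ) (hk : k ∈ Finset.range n) :
        ∫ x, |birkhoffSum T φ k x| / (δ * n) ∂μ ≤ δ⁻¹ * a k := by
      rw [integral_div]
      rcases k.eq_zero_or_pos with rfl | hk0
      · simp [a]
      have hk0' : (0 : ℝ) < k := by exact_mod_cast hk0
      have hkn : (k : ℝ) ≤ n := by exact_mod_cast (Finset.mem_range.1 hk).le
      have hak : ∫ x, |birkhoffSum T φ k x| ∂μ = a k * k := by simp [a, hk0'.ne']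
      rw [hak, div_le_iff₀ hR]
      calc a k * k ≤ a k * n := by gcongr
        _ = δ⁻¹ * a k * (δ * n) := by field_simp
    simp only [Pi.add_apply] at h
    rw [integral_finsetSum _ fun k _ => hki k, integral_add (integrable_const _)
      (integrable_finsetSum _ fun k _ => hli k), integral_finsetSum _ fun k _ => hli k,
      Finset.sum_congr rfl fun k _ => hleft k] at h
    simp only [Finset.sum_const, Finset.card_range, nsmul_eq_mul, integral_const,
      probReal_univ, one_smul] at h
    have h' := h.trans (add_le_add_right (Finset.sum_le_sum hright) _)
    rw [← Finset.mul_sum] at h'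
    refine le_of_mul_le_mul_left (h'.trans_eq ?_) hn'
    field_simp
  have hle {δ : ℝ} (hδ : 0 < δ) : μ.real B ≤ N * (2 * (δ / ε)) := by
    have hinv : Tendsto (fun n : ℕ => (n : ℝ)⁻¹) atTop (𝓝 0) :=
      tendsto_inv_atTop_nhds_zero_nat
    have hlim := (((hinv.const_mul 2).const_add (2 * (δ / ε))).const_mul (N : ℝ)).add
      (ha.cesaro.const_mul δ⁻¹)
    simp only [mul_zero, add_zero] at hlim
    exact ge_of_tendsto hlim ((eventually_gt_atTop 0).mono fun n hn => hbound hδ hn)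
  have hlim : Tendsto (fun δ : ℝ => N * (2 * (δ / ε))) (𝓝[>] 0) (𝓝 0) := by
    have : Continuous fun δ : ℝ => N * (2 * (δ / ε)) := by fun_prop
    simpa using (this.tendsto 0).mono_left nhdsWithin_le_nhds
  have hzero : μ.real B ≤ 0 :=
    ge_of_tendsto hlim (eventually_mem_nhdsWithin.mono fun δ hδ => hle hδ)
  exact (measureReal_eq_zero_iff).1 (le_antisymm hzero measureReal_nonneg)

/-- Proposition 3.16 (Atkinson's theorem): for an ergodic invertible measure-preserving
transformation and an integrable function of zero mean, almost every point has Birkhoff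
sums smaller than `ε` in absolute value for infinitely many times. -/
theorem statement11 {X : Type*} [MeasurableSpace X] (μ : Measure X)
    (hprob : IsProbabilityMeasure μ)
    (T : X → X) (hT : Measurable T)
    (hinv : ∃ Tinv : X → X, Measurable Tinv ∧ Function.LeftInverse Tinv T ∧
      Function.RightInverse Tinv T)
    (herg : Ergodic T μ)
    (φ : X → ℝ) (hφint : Integrable φ μ) (hmean : ∫ x, φ x ∂μ = 0)
    (ε : ℝ) (hε : 0 < ε) :
    μ {x | {n : ℕ | |∑ i ∈ Finset.range n, φ (T^[i] x)| < ε}.Infinite} = 1 := by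
  obtain ⟨φ', hφ'm, hφφ'⟩ := hφint.aemeasurable
  have hφ'i : Integrable φ' μ := hφint.congr hφφ'
  have hφ'0 : ∫ x, φ' x ∂μ = 0 := (integral_congr_ae hφφ').symm.trans hmean
  have hnull (N : ℕ) : ∀ᵐ x ∂μ, ¬ ∀ m ≥ N, ε ≤ |birkhoffSum T φ' m x| :=
    measure_eq_zero_iff_ae_notMem.1
      (herg.measure_forall_le_abs_birkhoffSum_eq_zero hφ'm hφ'i hφ'0 hε N)
  have hsum (n : ℕ) : birkhoffSum T φ n =ᵐ[μ] birkhoffSum T φ' n :=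
    herg.quasiMeasurePreserving.birkhoffSum_ae_eq_of_ae_eq hφφ' n
  rw [← measure_univ (μ := μ)]
  refine measure_congr (eventuallyEq_univ.2 ?_)
  filter_upwards [ae_all_iff.2 hnull, ae_all_iff.2 hsum] with x hx hx'
  refine Set.infinite_of_not_bddAbove fun ⟨N, hN⟩ => hx (N + 1) fun m hm => ?_
  rw [← hx' m]
  by_contra! hlt
  exact absurd (hN (show m ∈ _ from hlt)) (by omega)
end
end

section
/- Let h be a homeomorphism of S² and let A be an attractor of h with isolating block V, i.e., V is an open set with h(Cl(V)) ⊂ V and A = ⋂_{j≥0} h^j(Cl(V)); let A* = ⋂_{j≥0} h^{−j}(S² ∖ V) be its dual repellor. Then there is a C^∞ function H_A : S² → [0,1] such that (1) H_A^{−1}(0) = A and H_A^{−1}(1) = A*, and (2) H_A(h(x)) < H_A(x) for every x ∈ S² ∖ (A ∪ A*). -/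
noncomputable section

open Metric Set Function Filter MeasureTheory Topology Manifold

open scoped ContDiff

/-- Countably many smooth functions with compact support admit a convex combination with positive
weights whose sum is smooth. -/
lemma exists_pos_weights_contDiff_tsum {ι E : Type*} [Encodable ι] [Nonempty ι]
    [NormedAddCommGroup E] [NormedSpace ℝ E] (f : ι → E → ℝ) (hf : ∀ i, ContDiff ℝ ∞ (f i))
    (hc : ∀ i, HasCompactSupport (f i)) :
    ∃ c : ι → ℝ, (∀ i, 0 < c i) ∧ HasSum c 1 ∧ ContDiff ℝ ∞ (fun x => ∑' i, c i • f i x) := by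
  have hbound : ∀ (k : ℕ) (i : ι), ∃ C, ∀ x, ‖iteratedFDeriv ℝ k (f i) x‖ ≤ C := fun k i =>
    ((hf i).continuous_iteratedFDeriv (by exact_mod_cast le_top)).bounded_above_of_compact_support
      ((hc i).iteratedFDeriv k)
  choose M hM using hbound
  let D : ι → ℝ := fun i => 1 + ∑ k ∈ Finset.range (Encodable.encode i + 1), |M k i|
  have hD : ∀ i, 1 ≤ D i := fun i =>
    le_add_of_nonneg_right (Finset.sum_nonneg fun _ _ => abs_nonneg _)
  have hD0 : ∀ i, 0 < D i := fun i => zero_lt_one.trans_le (hD i)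
  let b : ι → ℝ := fun i => (1 / 2) ^ Encodable.encode i / D i
  have hb : ∀ i, 0 < b i := fun i => div_pos (by positivity) (hD0 i)
  have hbs : Summable b := summable_geometric_two_encode.of_nonneg_of_le (fun i => (hb i).le)
    fun i => div_le_self (by positivity) (hD i)
  have hB : 0 < ∑' i, b i := hbs.tsum_pos (fun i => (hb i).le) (Classical.arbitrary ι) (hb _)
  set B := ∑' i, b i with hBdef
  refine ⟨fun i => b i / B, fun i => div_pos (hb i) hB, ?_, ?_⟩
  · have := hbs.hasSum.div_const B
    rwa [← hBdef, div_self hB.ne'] at this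
  · refine contDiff_tsum_of_eventually (v := fun _ i => (1 / 2) ^ Encodable.encode i / B)
      (fun i => (hf i).const_smul (b i / B))
      (fun k _ => summable_geometric_two_encode.div_const B) fun k _ => ?_
    have hev : ∀ᶠ i : ι in cofinite, k ≤ Encodable.encode i := by
      have := (Encodable.encode_injective (α := ι)).tendsto_cofinite
      rw [Nat.cofinite_eq_atTop] at this
      exact this.eventually_ge_atTop k
    filter_upwards [hev] with i hi x
    have hMD : M k i ≤ D i := by
      have h₁ : |M k i| ≤ ∑ k ∈ Finset.range (Encodable.encode i + 1), |M k i| :=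
        Finset.single_le_sum (f := fun k => |M k i|) (fun _ _ => abs_nonneg _)
          (Finset.mem_range.2 (Nat.lt_succ_of_le hi))
      have h₂ := le_abs_self (M k i)
      change M k i ≤ 1 + _
      linarith
    have hsmul : iteratedFDeriv ℝ k ((b i / B) • f i) x
        = (b i / B) • iteratedFDeriv ℝ k (f i) x :=
      iteratedFDeriv_const_smul_apply
        (((hf i).of_le (by exact_mod_cast le_top)).contDiffAt)
    change ‖iteratedFDeriv ℝ k ((b i / B) • f i) x‖ ≤ _
    rw [hsmul, norm_smul, Real.norm_of_nonneg (div_pos (hb i) hB).le]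
    calc b i / B * ‖iteratedFDeriv ℝ k (f i) x‖ ≤ b i / B * D i :=
          mul_le_mul_of_nonneg_left ((hM k i x).trans hMD) (div_pos (hb i) hB).le
      _ = (1 / 2) ^ Encodable.encode i / B := by
          have := (hD0 i).ne'
          simp only [b]
          field_simp

/-- A smooth Urysohn function on the sphere, as the restriction of a smooth function with compact
support on the ambient space. -/
lemma exists_contDiff_sphere_zero_iff_one_iff {s t : Set S2} (hs : IsClosed s) (ht : IsClosed t)
    (hd : Disjoint s t) :
    ∃ g : EuclideanSpace ℝ (Fin 3) → ℝ, ContDiff ℝ ∞ g ∧ HasCompactSupport g ∧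
      ∀ x : S2, g x ∈ Icc (0 : ℝ) 1 ∧ (x ∈ s ↔ g x = 0) ∧ (x ∈ t ↔ g x = 1) := by
  have hs' : IsClosed ((↑) '' s : Set (EuclideanSpace ℝ (Fin 3))) :=
    (hs.isCompact.image continuous_subtype_val).isClosed
  have ht' : IsClosed ((↑) '' t : Set (EuclideanSpace ℝ (Fin 3))) :=
    (ht.isCompact.image continuous_subtype_val).isClosed
  obtain ⟨f, hf, hrange, hf0, hf1⟩ := exists_contMDiff_zero_iff_one_iff_of_isClosed (n := ⊤)
    𝓘(ℝ, EuclideanSpace ℝ (Fin 3)) hs' ht'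
    ((disjoint_image_iff Subtype.val_injective).2 hd)
  let χ : ContDiffBump (0 : EuclideanSpace ℝ (Fin 3)) := ⟨1, 2, one_pos, one_lt_two⟩
  have hχ : ∀ x : S2, χ (x : EuclideanSpace ℝ (Fin 3)) = 1 := fun x =>
    χ.one_of_mem_closedBall (sphere_subset_closedBall x.2)
  refine ⟨fun x => χ x * f x, χ.contDiff.mul hf.contDiff, χ.hasCompactSupport.mul_right,
    fun x => ?_⟩
  simp only [hχ, one_mul]
  refine ⟨hrange (mem_range_self _), ?_, ?_⟩
  · rw [← hf0, Subtype.val_injective.mem_set_image]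
  · rw [← hf1, Subtype.val_injective.mem_set_image]

/-- A smooth Lyapunov function for a bi-infinite nested sequence of open sets `W n` and closed sets
`K n` shifted by a map of the sphere. -/
lemma exists_contMDiff_lyapunov_of_nested (h : S2 → S2) (W K : ℤ → Set S2)
    (hW : ∀ n, IsOpen (W n)) (hK : ∀ n, IsClosed (K n)) (hWK : ∀ n, W n ⊆ K n)
    (hKW : ∀ n, K (n + 1) ⊆ W n) (hhW : ∀ n x, h x ∈ W (n + 1) ↔ x ∈ W n)
    (hhK : ∀ n x, h x ∈ K (n + 1) ↔ x ∈ K n) :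
    ∃ H : S2 → ℝ, ContMDiff (𝓡 2) 𝓘(ℝ, ℝ) (⊤ : ℕ∞) H ∧ (∀ x, H x ∈ Icc (0 : ℝ) 1) ∧
      H ⁻¹' {0} = ⋂ n, K n ∧ H ⁻¹' {1} = ⋂ n, (W n)ᶜ ∧
      ∀ x, x ∉ (⋂ n, K n) ∪ ⋂ n, (W n)ᶜ → H (h x) < H x := by
  have hex := fun n : ℤ => exists_contDiff_sphere_zero_iff_one_iff (hK (n + 1))
    (hW n).isClosed_compl (disjoint_compl_right.mono_left (hKW n))
  choose g hg hgc hgx using hex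
  obtain ⟨c, hc, hc1, hsm⟩ := exists_pos_weights_contDiff_tsum g hg hgc
  have hanti : Antitone W := antitone_int_of_succ_le fun n => (hWK _).trans (hKW n)
  have hshift : ⋂ n, K n = ⋂ n, K (n + 1) :=
    ((Equiv.addRight (1 : ℤ)).surjective.iInter_comp K).symm
  have hnonneg : ∀ n (x : S2), 0 ≤ c n • g n x := fun n x =>
    mul_nonneg (hc n).le (hgx n x).1.1
  have hle : ∀ n (x : S2), c n • g n x ≤ c n := fun n x =>
    mul_le_of_le_one_right (hc n).le (hgx n x).1.2
  have hsum : ∀ x : S2, Summable fun n => c n • g n x := fun x =>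
    hc1.summable.of_nonneg_of_le (fun n => hnonneg n x) fun n => hle n x
  have hmono : ∀ n (x : S2), g n (h x) ≤ g n x := by
    intro n x
    by_cases hx : x ∈ W n
    · rw [((hgx n (h x)).2.1).1 ((hhK n x).2 (hWK n hx))]
      exact (hgx n x).1.1
    · rw [((hgx n x).2.2).1 hx]
      exact (hgx n (h x)).1.2
  refine ⟨fun x => ∑' n, c n • g n x, hsm.contMDiff.comp contMDiff_coe_sphere, fun x =>
    ⟨tsum_nonneg fun n => hnonneg n x, ?_⟩, ?_, ?_, ?_⟩
  · exact ((hsum x).tsum_le_tsum (fun n => hle n x) hc1.summable).trans_eq hc1.tsum_eq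
  · ext x
    rw [hshift, mem_preimage, mem_singleton_iff, mem_iInter]
    constructor
    · intro hx n
      rw [(hgx n x).2.1]
      by_contra hne
      have hlt : 0 < g n x := lt_of_le_of_ne (hgx n x).1.1 (Ne.symm hne)
      exact ((hsum x).tsum_pos (fun n => hnonneg n x) n (mul_pos (hc n) hlt)).ne' hx
    · intro hx
      simp [fun n => ((hgx n x).2.1).1 (hx n)]
  · ext x
    rw [mem_preimage, mem_singleton_iff, mem_iInter]
    constructor
    · intro hx n
      rw [(hgx n x).2.2]
      by_contra hne
      have hlt : g n x < 1 := lt_of_le_of_ne (hgx n x).1.2 hne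
      have := (hsum x).tsum_lt_tsum (fun n => hle n x) (i := n)
        (mul_lt_of_lt_one_right (hc n) hlt) hc1.summable
      rw [hc1.tsum_eq] at this
      exact this.ne hx
    · intro hx
      simpa [fun n => ((hgx n x).2.2).1 (hx n)] using hc1.tsum_eq
  · intro x hx
    obtain ⟨n, hn, hn'⟩ : ∃ n, x ∈ W n ∧ x ∉ W (n + 1) := by
      simp only [mem_union, mem_iInter, mem_compl_iff, not_or, not_forall, not_not] at hx
      obtain ⟨⟨m, hm⟩, k, hk⟩ := hx
      by_contra! hstep
      refine hm (hWK m ?_)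
      rcases le_total k m with hkm | hkm
      · exact Int.leInduction hk (fun n _ hn => hstep n hn) m hkm
      · exact hanti hkm hk
    refine (hsum (h x)).tsum_lt_tsum (i := n + 1)
      (fun n => mul_le_mul_of_nonneg_left (hmono n x) (hc n).le) ?_ (hsum x)
    refine mul_lt_mul_of_pos_left ?_ (hc _)
    rw [((hgx (n + 1) x).2.2).1 hn']
    refine lt_of_le_of_ne (hgx _ _).1.2 fun hone => ?_
    exact ((hgx (n + 1) (h x)).2.2).2 hone ((hhW n x).2 hn)

/-- Lemma 6.3 (la): a smooth Lyapunov function for an attractor-repellor pair. -/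
theorem statement14 (h : S2 ≃ₜ S2) (V : Set S2) (hV : IsOpen V)
    (hVmap : ⇑h '' closure V ⊆ V) (A Astar : Set S2)
    (hA : A = ⋂ j : ℕ, (⇑h)^[j] '' closure V)
    (hAstar : Astar = ⋂ j : ℕ, (⇑h)^[j] ⁻¹' Vᶜ) :
    ∃ HA : S2 → ℝ, ContMDiff (𝓡 2) 𝓘(ℝ, ℝ) (⊤ : ℕ∞) HA ∧
      (∀ x, HA x ∈ Set.Icc (0 : ℝ) 1) ∧
      HA ⁻¹' {0} = A ∧ HA ⁻¹' {1} = Astar ∧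
      ∀ x, x ∉ A ∪ Astar → HA (h x) < HA x := by
  have hpow : ∀ (j : ℕ) x, (h ^ j) x = (⇑h)^[j] x := by
    intro j
    induction j with
    | zero => exact fun x => rfl
    | succ j ih => exact fun x => by rw [pow_succ, Homeomorph.mul_apply, ih, iterate_succ_apply]
  let S : Set S2 → ℤ → Set S2 := fun U n => ⇑(h ^ (-n)) ⁻¹' U
  have hS : ∀ U n x, h x ∈ S U (n + 1) ↔ x ∈ S U n := fun U n x => by
    simp only [S, mem_preimage, ← Homeomorph.mul_apply, ← zpow_add_one]
    simp
  have hWK : ∀ n, S V n ⊆ S (closure V) n := fun n => preimage_mono subset_closure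
  have hKW : ∀ n, S (closure V) (n + 1) ⊆ S V n := fun n x hx => by
    have hx' := hVmap (mem_image_of_mem h hx)
    rw [← Homeomorph.mul_apply, ← zpow_one_add] at hx'
    simpa [S] using hx'
  have hantiW : Antitone (S V) := antitone_int_of_succ_le fun n => (hWK _).trans (hKW n)
  have hantiK : Antitone (S (closure V)) :=
    antitone_int_of_succ_le fun n => (hKW n).trans (hWK n)
  have hA' : A = ⋂ n, S (closure V) n := by
    have himage : ∀ j : ℕ, (⇑h)^[j] '' closure V = S (closure V) j := fun j => by
      rw [← funext (hpow j), Homeomorph.image_eq_preimage_symm]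
      simp only [S, zpow_neg, zpow_natCast]
      rfl
    rw [hA]
    simp only [himage]
    refine Subset.antisymm (subset_iInter fun n => ?_)
      (subset_iInter fun j => iInter_subset _ _)
    exact (iInter_subset _ n.toNat).trans (hantiK n.self_le_toNat)
  have hAstar' : Astar = ⋂ n, (S V n)ᶜ := by
    have hpreimage : ∀ j : ℕ, (⇑h)^[j] ⁻¹' Vᶜ = (S V (-j))ᶜ := fun j => by
      rw [← funext (hpow j)]
      simp only [S, neg_neg, zpow_natCast, preimage_compl]
    rw [hAstar]
    simp only [hpreimage]
    refine Subset.antisymm (subset_iInter fun n => ?_)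
      (subset_iInter fun j => iInter_subset _ _)
    refine (iInter_subset _ (-n).toNat).trans (compl_subset_compl.2 (hantiW ?_))
    have := (-n).self_le_toNat
    omega
  rw [hA', hAstar']
  exact exists_contMDiff_lyapunov_of_nested h (S V) (S (closure V))
    (fun n => hV.preimage (h ^ (-n)).continuous)
    (fun n => isClosed_closure.preimage (h ^ (-n)).continuous) hWK hKW (hS V) (hS (closure V))
end
end

section
/- Let f_α and f_β be orientation-preserving homeomorphisms of S¹, let (φ_t)_{t∈ℝ} be a family of homeomorphisms of S¹, continuous in (t, θ), with φ_t = f_α for all t ≥ 5 and φ_t = f_β for all t ≤ −5, and let g : S¹ × ℝ → [0,1] be a continuous function, differentiable in the ℝ-direction, with g ≡ 1 on S¹ × ((−∞,−15] ∪ [−5,5] ∪ [15,∞)) and ∂g/∂t < 1 everywhere. Then the map h : S¹ × ℝ → S¹ × ℝ defined by h(θ, t) = (φ_t(θ), t − g(θ, t)) is a homeomorphism of the open annulus S¹ × ℝ. -/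
noncomputable section

open Metric Set Function Filter MeasureTheory Topology Manifold

/-- `f` is an orientation-preserving homeomorphism of the circle: it admits a strictly
increasing continuous lift `F` commuting with the unit translation. -/
def IsOPCircleHomeo (f : Circle1 ≃ₜ Circle1) : Prop :=
  ∃ F : ℝ → ℝ, Continuous F ∧ StrictMono F ∧
    (∀ x : ℝ, ((F x : Circle1)) = f ((x : Circle1))) ∧ ∀ x : ℝ, F (x + 1) = F x + 1

/-- A continuous bijection of the annulus that moves heights by a bounded amount
is a homeomorphism. -/
theorem exists_homeomorph_of_bounded_height (F : Ann → Ann) (hF : Continuous F)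
    (hbij : Bijective F) (C : ℝ) (hC : ∀ p, |(F p).2 - p.2| ≤ C) :
    ∃ e : Ann ≃ₜ Ann, ∀ p, e p = F p := by
  have hproper : IsProperMap F := by
    rw [isProperMap_iff_isCompact_preimage]
    refine ⟨hF, fun K hK => ?_⟩
    obtain ⟨a, ha⟩ := (hK.image continuous_snd).bddBelow
    obtain ⟨b, hb⟩ := (hK.image continuous_snd).bddAbove
    refine (isCompact_univ.prod (isCompact_Icc (a := a - C) (b := b + C))).of_isClosed_subset
      (hK.isClosed.preimage hF) fun p hp => ⟨mem_univ _, ?_⟩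
    have h₁ := ha (mem_image_of_mem _ hp)
    have h₂ := hb (mem_image_of_mem _ hp)
    have h₃ := abs_le.1 (hC p)
    exact ⟨by linarith [h₃.2], by linarith [h₃.1]⟩
  exact ⟨(Equiv.ofBijective F hbij).toHomeomorphOfContinuousClosed hF hproper.isClosedMap,
    fun _ => rfl⟩

/-- A function `t ↦ t - u t` with `u` bounded between `0` and `1` and `u' < 1` is strictly
increasing and surjective. -/
theorem strictMono_surjective_sub (u u' : ℝ → ℝ) (hu : ∀ t, HasDerivAt u (u' t) t)
    (hu' : ∀ t, u' t < 1) (hr : ∀ t, u t ∈ Icc (0 : ℝ) 1) :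
    StrictMono (fun t => t - u t) ∧ Surjective (fun t => t - u t) := by
  have hd : ∀ t, HasDerivAt (fun t => t - u t) (1 - u' t) t := fun t =>
    (hasDerivAt_id t).sub (hu t)
  refine ⟨strictMono_of_deriv_pos fun t => ?_, ?_⟩
  · rw [(hd t).deriv]
    linarith [hu' t]
  · have hc : Continuous (fun t => t - u t) :=
      continuous_iff_continuousAt.2 fun t => (hd t).continuousAt
    refine hc.surjective ?_ ?_
    · exact tendsto_atTop_mono (fun t => by simp only [id]; linarith [(hr t).2])
        (tendsto_atTop_add_const_right atTop (-1 : ℝ) tendsto_id)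
    · exact tendsto_atBot_mono (fun t => by simpa using (hr t).1) tendsto_id

/-- Section 2.3: the skew-product-like map `h(θ,t) = (φ_t(θ), t − g(θ,t))` is a
homeomorphism of the open annulus. -/
theorem statement15 (fα fβ : Circle1 ≃ₜ Circle1)
    (hfα : IsOPCircleHomeo fα) (hfβ : IsOPCircleHomeo fβ)
    (φ : ℝ → Circle1 ≃ₜ Circle1)
    (hφcont : Continuous (fun p : ℝ × Circle1 => φ p.1 p.2))
    (hφα : ∀ t : ℝ, 5 ≤ t → φ t = fα) (hφβ : ∀ t : ℝ, t ≤ -5 → φ t = fβ)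
    (g : Ann → ℝ) (hgcont : Continuous g) (hgrange : ∀ p, g p ∈ Set.Icc (0 : ℝ) 1)
    (g' : Ann → ℝ)
    (hgderiv : ∀ (θ : Circle1) (t : ℝ), HasDerivAt (fun s => g (θ, s)) (g' (θ, t)) t)
    (hg'lt : ∀ p, g' p < 1)
    (hg1 : ∀ (θ : Circle1) (t : ℝ), (t ≤ -15 ∨ (-5 ≤ t ∧ t ≤ 5) ∨ 15 ≤ t) → g (θ, t) = 1) :
    ∃ hmap : Ann ≃ₜ Ann, ∀ p : Ann, hmap p = (φ p.2 p.1, p.2 - g p) := by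
  have hmono θ := strictMono_surjective_sub (fun t => g (θ, t)) (fun t => g' (θ, t))
    (hgderiv θ) (fun t => hg'lt _) (fun t => hgrange _)
  have hshift : ∀ θ t, φ t = φ (t - g (θ, t) + 1) := by
    intro θ t
    have hm := (hmono θ).1.monotone
    rcases le_total t (-5) with h₁ | h₁
    · have h₂ := hm h₁
      simp only [hg1 θ (-5) (by norm_num)] at h₂
      rw [hφβ t h₁, hφβ _ (by linarith)]
    rcases le_total t 5 with h₂ | h₂
    · rw [hg1 θ t (Or.inr (Or.inl ⟨h₁, h₂⟩)), sub_add_cancel]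
    · have h₃ := hm h₂
      simp only [hg1 θ 5 (by norm_num)] at h₃
      rw [hφα t h₂, hφα _ (by linarith)]
  refine exists_homeomorph_of_bounded_height (fun p => (φ p.2 p.1, p.2 - g p)) ?_ ⟨?_, ?_⟩ 1 ?_
  · exact (hφcont.comp continuous_swap).prodMk (continuous_snd.sub hgcont)
  · rintro ⟨θ, t⟩ ⟨θ', t'⟩ h
    obtain ⟨h₁, h₂⟩ := Prod.mk.inj h
    simp only at h₁ h₂
    rw [hshift θ t, hshift θ' t', h₂] at h₁
    obtain rfl : θ = θ' := (φ _).injective h₁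
    exact congrArg (Prod.mk θ) ((hmono θ).1.injective h₂)
  · rintro ⟨ω, s⟩
    obtain ⟨t, ht⟩ := (hmono ((φ (s + 1)).symm ω)).2 s
    refine ⟨((φ (s + 1)).symm ω, t), ?_⟩
    simp only at ht
    refine Prod.ext ?_ ht
    change φ t _ = ω
    rw [hshift _ t, ht, Homeomorph.apply_symm_apply]
  · intro p
    obtain ⟨h₀, h₁⟩ := hgrange p
    rw [abs_le]
    constructor <;> simp only <;> linarith
end
end

section
/- Let f be a homeomorphism of the circle S¹ and let C ⊂ S¹ be a closed f-invariant set with empty interior such that S¹ ∖ C = ⋃_{i∈ℤ} f^i(I) for a single connected component I of S¹ ∖ C, the intervals f^i(I), i ∈ ℤ, being pairwise disjoint. Then there exists a continuous function g : S¹ → [0,1] such that g^{−1}(0) = C and, for every θ ∈ S¹ ∖ C, both Σ_{i≥0} g(f^i(θ)) = ∞ and Σ_{i≥0} g(f^{−i}(θ)) = ∞. -/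
noncomputable section

open Metric Set Function Filter MeasureTheory Topology Manifold

/-- The supremum of a family of nonnegative continuous functions indexed by `ℤ` and dominated
by `1 / (|n| + 1)` is continuous. -/
theorem continuous_iSup_of_le_one_div {X : Type*} [TopologicalSpace X] {u : ℤ → X → ℝ}
    (hu : ∀ n, Continuous (u n)) (h0 : ∀ n x, 0 ≤ u n x)
    (hle : ∀ n x, u n x ≤ 1 / (|(n : ℝ)| + 1)) (hb : ∀ x, BddAbove (range fun n => u n x)) :
    Continuous fun x => ⨆ n, u n x := by
  have hne : ∀ N : ℕ, (Finset.Icc (-N : ℤ) N).Nonempty := fun N => ⟨0, by simp⟩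
  have key : TendstoUniformly
      (fun (N : ℕ) x => (Finset.Icc (-N : ℤ) N).sup' (hne N) fun n => u n x)
      (fun x => ⨆ n, u n x) atTop := by
    rw [Metric.tendstoUniformly_iff]
    intro ε hε
    filter_upwards [tendsto_one_div_add_atTop_nhds_zero_nat.eventually (gt_mem_nhds hε)]
      with N hN x
    have h1 : (Finset.Icc (-N : ℤ) N).sup' (hne N) (fun n => u n x) ≤ ⨆ n, u n x :=
      Finset.sup'_le _ _ fun n _ => le_ciSup (hb x) n
    have h2 : 0 ≤ (Finset.Icc (-N : ℤ) N).sup' (hne N) fun n => u n x :=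
      (h0 0 x).trans (Finset.le_sup' (fun n => u n x) (by simp))
    have h3 : ⨆ n, u n x ≤
        (Finset.Icc (-N : ℤ) N).sup' (hne N) (fun n => u n x) + 1 / ((N : ℝ) + 1) := by
      refine ciSup_le fun n => ?_
      by_cases hn : n ∈ Finset.Icc (-N : ℤ) N
      · have := Finset.le_sup' (fun n => u n x) hn
        have : (0 : ℝ) ≤ 1 / ((N : ℝ) + 1) := by positivity
        linarith
      · have hN' : (N : ℝ) ≤ |(n : ℝ)| := by
          rw [Finset.mem_Icc, ← abs_le] at hn
          exact_mod_cast (not_le.mp hn).le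
        have : 1 / (|(n : ℝ)| + 1) ≤ 1 / ((N : ℝ) + 1) := by gcongr
        linarith [hle n x]
    rw [Real.dist_eq, abs_of_nonneg (by linarith)]
    linarith
  exact key.continuous (Frequently.of_forall fun N =>
    Continuous.finset_sup'_apply (hne N) fun n _ => hu n)

/-- Weights bounded below by a truncated harmonic sequence have divergent partial sums. -/
theorem tendsto_sum_atTop_of_min_one_div_le {a : ℕ → ℝ} {c : ℝ} (hc : 0 < c) (k : ℤ)
    (m : ℕ → ℤ) (hm : ∀ i, |m i| ≤ |k| + i)
    (ha : ∀ i, min c (1 / (|(m i : ℝ)| + 1)) ≤ a i) :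
    Tendsto (fun n : ℕ => ∑ i ∈ Finset.range n, a i) atTop atTop := by
  set d : ℝ := min c 1 / (|(k : ℝ)| + 1) with hd
  have hcm : 0 < min c 1 := lt_min hc one_pos
  have hk : (1 : ℝ) ≤ |(k : ℝ)| + 1 := by linarith [abs_nonneg (k : ℝ)]
  have hd0 : 0 < d := by positivity
  refine tendsto_atTop_mono (fun n => ?_)
    (Real.tendsto_sum_range_one_div_nat_succ_atTop.const_mul_atTop hd0)
  rw [Finset.mul_sum]
  refine Finset.sum_le_sum fun i _ => le_trans (le_min ?_ ?_) (ha i)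
  · calc d * (1 / ((i : ℝ) + 1)) ≤ d * 1 := by
          gcongr
          rw [div_le_one (by positivity)]
          linarith [i.cast_nonneg (α := ℝ)]
      _ ≤ min c 1 := by rw [mul_one]; exact div_le_self hcm.le hk
      _ ≤ c := min_le_left _ _
  · have hmi : |(m i : ℝ)| ≤ |(k : ℝ)| + i := by exact_mod_cast hm i
    calc d * (1 / ((i : ℝ) + 1)) = min c 1 / ((|(k : ℝ)| + 1) * (i + 1)) := by
          rw [hd]; field_simp
      _ ≤ 1 / (|(m i : ℝ)| + 1) := by
          refine div_le_div₀ zero_le_one (min_le_right _ _) (by positivity) ?_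
          nlinarith [mul_nonneg (abs_nonneg (k : ℝ)) (i.cast_nonneg (α := ℝ))]

theorem Homeomorph.continuous_toEquiv_zpow {X : Type*} [TopologicalSpace X] (f : X ≃ₜ X)
    (n : ℤ) : Continuous ⇑(f.toEquiv ^ n) := by
  obtain ⟨m, rfl | rfl⟩ := n.eq_nat_or_neg
  · rw [zpow_natCast, ← Equiv.Perm.iterate_eq_pow]
    exact f.continuous.iterate m
  · rw [zpow_neg, zpow_natCast, ← inv_pow, ← Equiv.Perm.iterate_eq_pow]
    exact f.symm.continuous.iterate m

/-- Section 2.2: existence of the weight function `g` with divergent forward and backward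
sums off the minimal set of a Denjoy-like circle homeomorphism. -/
theorem statement16 (f : Circle1 ≃ₜ Circle1)
    (C : Set Circle1) (hCclosed : IsClosed C) (hCinv : ⇑f '' C = C)
    (hCint : interior C = ∅)
    (I : Set Circle1) (hIcomp : ∃ x ∈ Cᶜ, I = connectedComponentIn Cᶜ x)
    (hcover : Cᶜ = ⋃ i : ℤ, ⇑(f.toEquiv ^ i) '' I)
    (hdisj : ∀ i j : ℤ, i ≠ j → Disjoint (⇑(f.toEquiv ^ i) '' I) (⇑(f.toEquiv ^ j) '' I)) :
    ∃ g : Circle1 → ℝ, Continuous g ∧ (∀ θ, g θ ∈ Set.Icc (0 : ℝ) 1) ∧ g ⁻¹' {0} = C ∧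
      ∀ θ : Circle1, θ ∉ C →
        Filter.Tendsto (fun n : ℕ => ∑ i ∈ Finset.range n, g ((⇑f)^[i] θ))
          Filter.atTop Filter.atTop ∧
        Filter.Tendsto (fun n : ℕ => ∑ i ∈ Finset.range n, g ((⇑f.symm)^[i] θ))
          Filter.atTop Filter.atTop := by
  have : LocallyConnectedSpace Circle1 :=
    (QuotientAddGroup.isQuotientMap_mk
      (N := AddSubgroup.zmultiples (1 : ℝ))).isCoinducing.locallyConnectedSpace
  have hIopen : IsOpen I := by
    obtain ⟨x, -, rfl⟩ := hIcomp
    exact hCclosed.isOpen_compl.connectedComponentIn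
  have hIne : Iᶜ.Nonempty := by
    obtain ⟨x, hx, hxI⟩ := hIcomp
    have hxmem : x ∈ I := hxI ▸ mem_connectedComponentIn hx
    have hx1 : x ∉ ⇑(f.toEquiv ^ (1 : ℤ)) '' I :=
      Set.disjoint_left.mp (hdisj 0 1 zero_ne_one) ⟨x, hxmem, by simp⟩
    exact ⟨(f.toEquiv ^ (1 : ℤ)).symm x, fun h => hx1 ⟨_, h, by simp⟩⟩
  have hpos : ∀ x ∈ I, 0 < infDist x Iᶜ := fun x hx =>
    (hIopen.isClosed_compl.notMem_iff_infDist_pos hIne).mp (not_not_intro hx)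
  set u : ℤ → Circle1 → ℝ := fun n θ =>
    min (infDist ((f.toEquiv ^ (-n)) θ) Iᶜ) (1 / (|(n : ℝ)| + 1)) with hu
  have hw : ∀ n : ℤ, (0 : ℝ) < 1 / (|(n : ℝ)| + 1) := fun n => by positivity
  have hu0 : ∀ n θ, 0 ≤ u n θ := fun n θ => le_min infDist_nonneg (hw n).le
  have hule : ∀ n θ, u n θ ≤ 1 / (|(n : ℝ)| + 1) := fun n θ => min_le_right _ _
  have hu1 : ∀ n θ, u n θ ≤ 1 := fun n θ => (hule n θ).trans <| by
    rw [div_le_one (by positivity)]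
    linarith [abs_nonneg (n : ℝ)]
  have hb : ∀ θ, BddAbove (range fun n => u n θ) := fun θ =>
    ⟨1, forall_mem_range.mpr fun n => hu1 n θ⟩
  have hmemC : ∀ θ, θ ∉ C ↔ ∃ k : ℤ, (f.toEquiv ^ (-k)) θ ∈ I := by
    intro θ
    rw [← mem_compl_iff, hcover, mem_iUnion]
    refine exists_congr fun k => ?_
    rw [zpow_neg, Equiv.image_eq_preimage_symm]
    rfl
  refine ⟨fun θ => ⨆ n, u n θ, ?_, ?_, ?_, ?_⟩
  · exact continuous_iSup_of_le_one_div (fun n => ((continuous_infDist_pt _).comp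
      (f.continuous_toEquiv_zpow _)).min continuous_const) hu0 hule hb
  · exact fun θ => ⟨Real.iSup_nonneg fun n => hu0 n θ, ciSup_le fun n => hu1 n θ⟩
  · ext θ
    rw [mem_preimage, mem_singleton_iff]
    constructor
    · contrapose
      intro hθ
      obtain ⟨k, hk⟩ := (hmemC θ).mp hθ
      exact ((lt_min (hpos _ hk) (hw k)).trans_le (le_ciSup (hb θ) k)).ne'
    · intro hθ
      have hz : ∀ n, u n θ = 0 := fun n => by
        have : (f.toEquiv ^ (-n)) θ ∈ Iᶜ := fun h => (hmemC θ).mpr ⟨n, h⟩ hθ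
        rw [hu]
        simp only [infDist_zero_of_mem this]
        exact min_eq_left (hw n).le
      simp [hz]
  · intro θ hθ
    obtain ⟨k, hk⟩ := (hmemC θ).mp hθ
    have hshift : ∀ (j : ℤ), min (infDist ((f.toEquiv ^ (-k)) θ) Iᶜ)
        (1 / (|((k + j : ℤ) : ℝ)| + 1)) ≤ ⨆ n, u n ((f.toEquiv ^ j) θ) := by
      intro j
      refine le_trans (le_of_eq ?_) (le_ciSup (hb _) (k + j))
      rw [hu]
      simp only [← Equiv.Perm.mul_apply, ← zpow_add]
      rw [show -(k + j) + j = -k by ring]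
    constructor
    · refine tendsto_sum_atTop_of_min_one_div_le (hpos _ hk) k (fun i => k + i)
        (fun i => (abs_add_le _ _).trans (by simp)) fun i => ?_
      have h := hshift i
      rwa [zpow_natCast, ← Equiv.Perm.iterate_eq_pow] at h
    · refine tendsto_sum_atTop_of_min_one_div_le (hpos _ hk) k (fun i => k + -i)
        (fun i => (abs_add_le _ _).trans (by simp)) fun i => ?_
      have h := hshift (-i)
      rwa [zpow_neg _ (i : ℤ), zpow_natCast, ← inv_pow, ← Equiv.Perm.iterate_eq_pow] at h
end
end

section
/- Let 𝔸 = S¹ × ℝ be the open annulus and δ > 0. Let p₁, …, p_n and q₁, …, q_n be points of 𝔸 such that the p_i are pairwise distinct, the q_i are pairwise distinct, and d(p_i, q_i) < δ for every i. Then there exists a homeomorphism φ of 𝔸, isotopic to the identity, such that φ(p_i) = q_i for all i and sup_{z∈𝔸} d(φ(z), z) < 2δ. -/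
noncomputable section

open Metric Set Function Filter MeasureTheory Topology Manifold

/-- Composites of maps isotopic to the identity are isotopic to the identity. -/
theorem IsotopicToId.trans {X : Type*} [TopologicalSpace X] {f g : X ≃ₜ X}
    (hf : IsotopicToId f) (hg : IsotopicToId g) : IsotopicToId (f.trans g) := by
  obtain ⟨F, hF, hF0, hF1⟩ := hf
  obtain ⟨G, hG, hG0, hG1⟩ := hg
  refine ⟨fun s => (F s).trans (G s), ?_, ?_, ?_⟩
  · exact hG.comp (continuous_fst.prodMk hF)
  · simp only [hF0, hG0]
    rfl
  · simp only [hF1, hG1]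

/-- The horizontal shear `(x, t) ↦ (x + b t, t)` of the annulus. -/
def horizontalShear (b : C(ℝ, ℝ)) : Ann ≃ₜ Ann where
  toFun z := (z.1 + ((b z.2 : ℝ) : Circle1), z.2)
  invFun z := (z.1 - ((b z.2 : ℝ) : Circle1), z.2)
  left_inv z := by simp
  right_inv z := by simp
  continuous_toFun := (continuous_fst.add ((AddCircle.continuous_mk' 1).comp
    (b.continuous.comp continuous_snd))).prodMk continuous_snd
  continuous_invFun := (continuous_fst.sub ((AddCircle.continuous_mk' 1).comp
    (b.continuous.comp continuous_snd))).prodMk continuous_snd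

/-- The vertical shear `(x, t) ↦ (x, t + a x)` of the annulus. -/
def verticalShear (a : C(Circle1, ℝ)) : Ann ≃ₜ Ann where
  toFun z := (z.1, z.2 + a z.1)
  invFun z := (z.1, z.2 - a z.1)
  left_inv z := by simp
  right_inv z := by simp
  continuous_toFun := by fun_prop
  continuous_invFun := by fun_prop

theorem isotopicToId_horizontalShear (b : C(ℝ, ℝ)) : IsotopicToId (horizontalShear b) := by
  refine ⟨fun s => horizontalShear (s • b), ?_, ?_, ?_⟩
  · change Continuous fun p : ℝ × Ann => (p.2.1 + ((p.1 * b p.2.2 : ℝ) : Circle1), p.2.2)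
    have h : Continuous fun p : ℝ × Ann => p.1 * b p.2.2 := by fun_prop
    exact ((continuous_fst.comp continuous_snd).add
      ((AddCircle.continuous_mk' 1).comp h)).prodMk (continuous_snd.comp continuous_snd)
  · ext z <;> simp [horizontalShear]
  · simp

theorem isotopicToId_verticalShear (a : C(Circle1, ℝ)) : IsotopicToId (verticalShear a) := by
  refine ⟨fun s => verticalShear (s • a), ?_, ?_, ?_⟩
  · change Continuous fun p : ℝ × Ann => (p.2.1, p.2.2 + p.1 * a p.2.1)
    fun_prop
  · ext z <;> simp [verticalShear]
  · simp

/-- Interpolation at finitely many points of a normal space, with a strict bound. -/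
theorem exists_continuousMap_interpolating {ι X : Type*} [Finite ι] [TopologicalSpace X] [T4Space X]
    {x : ι → X} (hx : Injective x) {c : ι → ℝ} {δ : ℝ} (hδ : 0 < δ) (hc : ∀ i, |c i| < δ) :
    ∃ a : C(X, ℝ), (∀ i, a (x i) = c i) ∧ ∀ y, |a y| < δ := by
  have := Fintype.ofFinite ι
  let _ : TopologicalSpace ι := ⊥
  have : DiscreteTopology ι := ⟨rfl⟩
  have hemb : IsClosedEmbedding x :=
    .of_continuous_injective_isClosedMap continuous_of_discreteTopology hx
      fun s _ => (s.toFinite.image x).isClosed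
  obtain ⟨g, hg, hgx⟩ := BoundedContinuousFunction.exists_extension_norm_eq_of_isClosedEmbedding
    (BoundedContinuousFunction.mkOfCompact ⟨c, continuous_of_discreteTopology⟩) hemb
  refine ⟨g.toContinuousMap, fun i => congrFun hgx i, fun y => (g.norm_coe_le_norm y).trans_lt ?_⟩
  rw [hg, BoundedContinuousFunction.norm_lt_iff_of_compact hδ]
  exact hc

/-- A finite set of points of a product can be put in general position, with pairwise distinct
first coordinates, by an arbitrarily small shear along the first factor. -/
theorem exists_small_shear_injective {ι G X : Type*} [Finite ι] [AddCommGroup G]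
    [TopologicalSpace G] [IsTopologicalAddGroup G] [T2Space G] [TopologicalSpace X] [T4Space X]
    (e : ℝ →+ G) (he : Continuous e) (he' : ∀ᶠ r in 𝓝[≠] (0 : ℝ), e r ≠ 0)
    (x : ι → G) (y : ι → X) (hxy : Injective fun i => (x i, y i)) {η : ℝ} (hη : 0 < η) :
    ∃ u : C(X, ℝ), (∀ z, |u z| < η) ∧ Injective fun i => x i + e (u (y i)) := by
  obtain ⟨k, ⟨f⟩⟩ := Finite.exists_equiv_fin (range y)
  obtain ⟨g, hg, hgb⟩ := exists_continuousMap_interpolating (x := ((↑) : range y → X))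
    Subtype.val_injective (c := fun s => ((f s : ℕ) : ℝ)) (δ := k + 1) (by positivity)
    (fun s => by
      rw [abs_of_nonneg (by positivity)]
      exact_mod_cast (f s).2.trans (Nat.lt_succ_self k))
  have hinj : ∀ i j, g (y i) = g (y j) → y i = y j := by
    intro i j hij
    have h := hg ⟨y i, mem_range_self i⟩
    rw [hij, hg ⟨y j, mem_range_self j⟩] at h
    exact (congrArg Subtype.val (f.injective (Fin.ext (by exact_mod_cast h)))).symm
  have hsmall : ∀ᶠ ε in 𝓝[>] (0 : ℝ), ε * (k + 1) < η := by
    have h : Tendsto (fun ε : ℝ => ε * (k + 1)) (𝓝 0) (𝓝 0) :=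
      Continuous.tendsto' (by fun_prop) _ _ (by simp)
    exact (h.eventually (gt_mem_nhds hη)).filter_mono nhdsWithin_le_nhds
  have hdist : ∀ᶠ ε in 𝓝[>] (0 : ℝ), ∀ i j, i ≠ j →
      x i + e (ε * g (y i)) ≠ x j + e (ε * g (y j)) := by
    refine eventually_all.2 fun i => eventually_all.2 fun j => ?_
    by_cases hij : i = j
    · simp [hij]
    by_cases hx : x i = x j
    · have hne : g (y i) - g (y j) ≠ 0 := fun h =>
        hij (hxy (Prod.ext hx (hinj i j (sub_eq_zero.1 h))))
      have ht : Tendsto (fun ε : ℝ => ε * (g (y i) - g (y j))) (𝓝[>] 0) (𝓝[≠] 0) := by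
        refine tendsto_nhdsWithin_iff.2 ⟨?_, ?_⟩
        · exact (Continuous.tendsto' (by fun_prop) _ _ (by simp)).mono_left nhdsWithin_le_nhds
        · filter_upwards [self_mem_nhdsWithin] with ε hε
          exact mul_ne_zero (ne_of_gt hε) hne
      filter_upwards [ht.eventually he'] with ε hε _ h
      apply hε
      rw [hx, add_right_inj] at h
      rw [mul_sub, map_sub, h, sub_self]
    · have hc : ∀ m, Tendsto (fun ε : ℝ => x m + e (ε * g (y m))) (𝓝[>] 0) (𝓝 (x m)) := fun m =>
        (Continuous.tendsto' (by fun_prop) _ _ (by simp)).mono_left nhdsWithin_le_nhds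
      filter_upwards [(((hc i).prodMk_nhds (hc j)).eventually
        (isOpen_ne_fun continuous_fst continuous_snd |>.mem_nhds hx))] with ε hε _
      exact hε
  obtain ⟨ε, ⟨hε, hεη⟩, hεd⟩ := ((eventually_mem_nhdsWithin.and hsmall).and hdist).exists
  refine ⟨ε • g, fun z => ?_, fun i j h => by_contra fun hij => hεd i j hij h⟩
  have hε0 : 0 < ε := hε
  calc |(ε • g) z| = ε * |g z| := by simp [abs_mul, abs_of_pos hε0]
    _ ≤ ε * (k + 1) := by gcongr; exact (hgb z).le
    _ < η := hεη

theorem norm_coe_circle1_le (r : ℝ) : ‖(r : Circle1)‖ ≤ |r| :=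
  QuotientAddGroup.norm_mk_le_norm

theorem exists_real_lift_of_norm_lt {x : Circle1} {δ : ℝ} (h : ‖x‖ < δ) :
    ∃ r : ℝ, (r : Circle1) = x ∧ |r| < δ :=
  QuotientAddGroup.norm_lt_iff.1 h

theorem eventually_coe_circle1_ne_zero : ∀ᶠ r : ℝ in 𝓝[≠] 0, (r : Circle1) ≠ 0 := by
  have h : ∀ᶠ r : ℝ in 𝓝[≠] 0, |r| < 1 / 2 :=
    (Continuous.tendsto' (by fun_prop : Continuous fun r : ℝ => |r|) 0 0 (by simp)).eventually
      (gt_mem_nhds (by norm_num)) |>.filter_mono nhdsWithin_le_nhds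
  filter_upwards [h, self_mem_nhdsWithin] with r hr hr0 hz
  have hn : ‖(r : Circle1)‖ = |r| :=
    (AddCircle.norm_coe_eq_abs_iff (1 : ℝ) one_ne_zero).2 (by simpa using hr.le)
  rw [hz, norm_zero] at hn
  exact hr0 (abs_eq_zero.1 hn.symm)

/-- Section 3.3 (Figure 3): moving finitely many points by a homeomorphism which is
uniformly `2δ`-close to the identity. -/
theorem statement17 (δ : ℝ) (hδ : 0 < δ) (n : ℕ) (p q : Fin n → Ann)
    (hp : Function.Injective p) (hq : Function.Injective q)
    (hpq : ∀ i, dist (p i) (q i) < δ) :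
    ∃ φ : Ann ≃ₜ Ann, IsotopicToId φ ∧ (∀ i, φ (p i) = q i) ∧
      ∀ z : Ann, dist (φ z) z < 2 * δ := by
  have hlift : ∀ i, ∃ r : ℝ, (r : Circle1) = (q i).1 - (p i).1 ∧ |r| < δ := fun i =>
    exists_real_lift_of_norm_lt <| by
      rw [← dist_eq_norm, dist_comm]
      exact (le_max_left _ _).trans_lt (hpq i)
  choose r hr hrδ using hlift
  have hvert : ∀ i, |(q i).2 - (p i).2| < δ := fun i => by
    rw [← Real.dist_eq, dist_comm]
    exact (le_max_right _ _).trans_lt (hpq i)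
  obtain ⟨η, hη, hηδ, hηr, hηv⟩ : ∃ η > 0, η < δ ∧ (∀ i, η < δ - |r i|) ∧
      ∀ i, η < δ - |(q i).2 - (p i).2| := by
    have hsmall : ∀ m > (0 : ℝ), ∀ᶠ η in 𝓝[>] (0 : ℝ), η < m := fun m hm =>
      (gt_mem_nhds hm).filter_mono nhdsWithin_le_nhds
    exact (eventually_mem_nhdsWithin.and ((hsmall δ hδ).and
      ((eventually_all.2 fun i => hsmall _ (sub_pos.2 (hrδ i))).and
        (eventually_all.2 fun i => hsmall _ (sub_pos.2 (hvert i)))))).exists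
  obtain ⟨u, hu, hpu⟩ := exists_small_shear_injective
    (QuotientAddGroup.mk' (AddSubgroup.zmultiples (1 : ℝ)) : ℝ →+ Circle1)
    (AddCircle.continuous_mk' 1) eventually_coe_circle1_ne_zero
    (fun i => (p i).1) (fun i => (p i).2) hp hη
  obtain ⟨w, hw, hqw⟩ := exists_small_shear_injective (AddMonoidHom.id ℝ) continuous_id
    self_mem_nhdsWithin (fun i => (q i).2) (fun i => (q i).1)
    (fun i j h => hq (Prod.swap_injective h)) hη
  obtain ⟨a, ha, haδ⟩ := exists_continuousMap_interpolating hpu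
    (c := fun i => (q i).2 - (p i).2 + w (q i).1) hδ fun i => by
      linarith [abs_add_le ((q i).2 - (p i).2) (w (q i).1), hηv i, hw (q i).1]
  obtain ⟨b, hb, hbδ⟩ := exists_continuousMap_interpolating hqw
    (c := fun i => r i - u (p i).2) hδ fun i => by
      linarith [abs_sub (r i) (u (p i).2), hηr i, hu (p i).2]
  refine ⟨(horizontalShear u).trans <| (verticalShear a).trans <|
    (horizontalShear b).trans (verticalShear (-w)), ?_, fun i => ?_, fun z => ?_⟩
  · exact (isotopicToId_horizontalShear u).trans <| (isotopicToId_verticalShear a).trans <|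
      (isotopicToId_horizontalShear b).trans (isotopicToId_verticalShear (-w))
  · change ∀ i, a ((p i).1 + ((u (p i).2 : ℝ) : Circle1)) = _ at ha
    change ∀ i, b ((q i).2 + w (q i).1) = _ at hb
    have h2 : (p i).2 + a ((p i).1 + ((u (p i).2 : ℝ) : Circle1)) = (q i).2 + w (q i).1 := by
      rw [ha]; ring
    have h1 : (p i).1 + ((u (p i).2 : ℝ) : Circle1) +
        ((r i - u (p i).2 : ℝ) : Circle1) = (q i).1 := by
      rw [AddCircle.coe_sub, hr]; abel
    change ((p i).1 + ((u (p i).2 : ℝ) : Circle1) +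
        ((b ((p i).2 + a ((p i).1 + ((u (p i).2 : ℝ) : Circle1))) : ℝ) : Circle1),
      (p i).2 + a ((p i).1 + ((u (p i).2 : ℝ) : Circle1)) + -w ((p i).1 +
        ((u (p i).2 : ℝ) : Circle1) +
        ((b ((p i).2 + a ((p i).1 + ((u (p i).2 : ℝ) : Circle1))) : ℝ) : Circle1))) = q i
    rw [h2, hb, h1, add_neg_cancel_right]
  · set y := z.2 + a (z.1 + ((u z.2 : ℝ) : Circle1)) with hy
    set x := z.1 + ((u z.2 : ℝ) : Circle1) + ((b y : ℝ) : Circle1) with hx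
    change dist ((x, y + -w x) : Ann) z < 2 * δ
    refine max_lt ?_ ?_
    · have h : x - z.1 = ((u z.2 + b y : ℝ) : Circle1) := by
        rw [hx, AddCircle.coe_add]; abel
      change dist x z.1 < _
      rw [dist_eq_norm, h]
      linarith [norm_coe_circle1_le (u z.2 + b y), abs_add_le (u z.2) (b y), hu z.2, hbδ y]
    · change |y + -w x - z.2| < _
      have h : y + -w x - z.2 = a (z.1 + ((u z.2 : ℝ) : Circle1)) - w x := by rw [hy]; ring
      rw [h]
      linarith [abs_sub (a (z.1 + ((u z.2 : ℝ) : Circle1))) (w x), hw x,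
        haδ (z.1 + ((u z.2 : ℝ) : Circle1))]
end
end

section
/- Let h be a homeomorphism of the open annulus 𝔸 = S¹ × ℝ preserving the measure m given by the area form dθ ∧ dt, and suppose h(θ, t) = (θ, t − 1) whenever |t| ≥ 10. Then there is no compact connected h-invariant subset K of 𝔸 that separates the two ends of 𝔸 (i.e., no compact connected K with h(K) = K such that, for c large enough, S¹ × [c, ∞) and S¹ × (−∞, −c] lie in different connected components of 𝔸 ∖ K). -/
noncomputable section

open Metric Set Function Filter MeasureTheory Topology Manifold

/-- If `h` sends `(θ, t)` to `(θ, t - 1)` for all `t ≥ M`, then it maps the half-annulus below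
height `M` exactly onto the half-annulus below height `M - 1`. -/
theorem snd_apply_lt_iff (h : Ann ≃ₜ Ann) {M : ℝ}
    (hM : ∀ (θ : Circle1) (t : ℝ), M ≤ t → h (θ, t) = (θ, t - 1)) (p : Ann) :
    (h p).2 < M - 1 ↔ p.2 < M := by
  rw [← not_le, ← not_le, not_iff_not]
  constructor
  · intro hp
    have key : h ((h p).1, (h p).2 + 1) = h p := by
      rw [hM _ _ (by linarith), add_sub_cancel_right]
    rw [← h.injective key]
    exact sub_le_iff_le_add.mp hp
  · intro hp
    rw [hM p.1 p.2 hp]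
    exact sub_le_sub_right hp 1

/-- A closed end `S¹ × [c, ∞)` contained in `F` lies in a single component of `F`. -/
theorem subset_connectedComponentIn_of_upper {F : Set Ann} {c : ℝ}
    (hF : ∀ x : Ann, c ≤ x.2 → x ∈ F) {x y : Ann} (hx : c ≤ x.2) (hy : c ≤ y.2) :
    y ∈ connectedComponentIn F x := by
  have hconn : IsPreconnected ((univ : Set Circle1) ×ˢ Ici c) :=
    isPreconnected_univ.prod isPreconnected_Ici
  exact hconn.subset_connectedComponentIn (x := x) ⟨mem_univ _, hx⟩ (fun z hz => hF z hz.2)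
    ⟨mem_univ _, hy⟩

/-- No set `U` that is bounded below and contains an upper end can be invariant under an
area-preserving homeomorphism that is a downward translation near `+∞`. -/
theorem preimage_ne_of_upper_end (h : Ann ≃ₜ Ann)
    (hm : MeasurePreserving (⇑h) (volume : Measure Ann) volume) {M b : ℝ}
    (hM : ∀ (θ : Circle1) (t : ℝ), M ≤ t → h (θ, t) = (θ, t - 1)) {U : Set Ann}
    (hup : ∀ x : Ann, M - 1 ≤ x.2 → x ∈ U) (hlow : ∀ x ∈ U, b ≤ x.2) :
    ⇑h ⁻¹' U ≠ U := by
  intro hU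
  have hmeas : MeasurableSet {p : Ann | p.2 < M - 1} :=
    measurableSet_lt measurable_snd measurable_const
  have hpre : ⇑h ⁻¹' (U ∩ {p | p.2 < M - 1}) = U ∩ {p | p.2 < M} := by
    rw [preimage_inter, hU]
    congr 1
    ext p
    exact snd_apply_lt_iff h hM p
  have heq : volume (U ∩ {p : Ann | p.2 < M}) = volume (U ∩ {p : Ann | p.2 < M - 1}) := by
    rw [← hpre]
    exact MeasurePreserving.measure_preimage_equiv (f := h.toMeasurableEquiv) hm _
  have hfin : volume (U ∩ {p : Ann | p.2 < M - 1}) ≠ ⊤ := by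
    have hcomp : IsCompact ((univ : Set Circle1) ×ˢ Icc b M) := isCompact_univ.prod isCompact_Icc
    refine ((measure_mono ?_).trans_lt (hcomp.measure_lt_top (μ := volume))).ne
    rintro p ⟨hpU, hp⟩
    exact ⟨mem_univ _, hlow p hpU, by linarith [mem_ofPred.mp hp]⟩
  have hsplit := measure_inter_add_sdiff (μ := volume) (U ∩ {p : Ann | p.2 < M}) hmeas
  have hinter : U ∩ {p : Ann | p.2 < M} ∩ {p | p.2 < M - 1} = U ∩ {p | p.2 < M - 1} := by
    ext p
    simp only [mem_inter_iff, mem_ofPred_eq]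
    exact ⟨fun hp => ⟨hp.1.1, hp.2⟩, fun hp => ⟨⟨hp.1, by linarith [hp.2]⟩, hp.2⟩⟩
  rw [hinter, heq] at hsplit
  have hzero : volume ((U ∩ {p : Ann | p.2 < M}) \ {p | p.2 < M - 1}) = 0 := by
    simpa using (ENNReal.add_right_inj hfin).mp (hsplit.trans (add_zero _).symm)
  have hstrip : volume ((univ : Set Circle1) ×ˢ Ico (M - 1) M) = 0 := by
    refine measure_mono_null ?_ hzero
    rintro p ⟨-, hp⟩
    exact ⟨⟨hup p hp.1, hp.2⟩, not_lt.mpr hp.1⟩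
  rw [Measure.volume_eq_prod, Measure.prod_prod] at hstrip
  simp [AddCircle.measure_univ] at hstrip

/-- Section 3.2: an area-preserving homeomorphism of the annulus which is a downward
translation near infinity admits no invariant continuum separating the two ends. -/
theorem statement18 (h : Ann ≃ₜ Ann)
    (hm : MeasurePreserving (⇑h) (volume : Measure Ann) volume)
    (hvert : ∀ (θ : Circle1) (t : ℝ), 10 ≤ |t| → h (θ, t) = (θ, t - 1)) :
    ¬ ∃ K : Set Ann, IsCompact K ∧ IsConnected K ∧ ⇑h '' K = K ∧
        ∃ c : ℝ, 0 < c ∧ (∀ x : Ann, c ≤ |x.2| → x ∉ K) ∧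
          ∀ x y : Ann, c ≤ x.2 → y.2 ≤ -c → y ∉ connectedComponentIn Kᶜ x := by
  rintro ⟨K, -, -, hK, c, -, hcK, hsep⟩
  set M : ℝ := max c 10 + 1 with hMdef
  have hcM : c ≤ M - 1 := by simp [hMdef]
  have hM10 : 10 ≤ M := by linarith [le_max_right c 10]
  have hM : ∀ (θ : Circle1) (t : ℝ), M ≤ t → h (θ, t) = (θ, t - 1) := fun θ t ht =>
    hvert θ t ((hM10.trans ht).trans (le_abs_self t))
  have hKc : ∀ x : Ann, c ≤ x.2 → x ∈ Kᶜ := fun x hx => hcK x (hx.trans (le_abs_self _))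
  let x₀ : Ann := (0, M)
  have hx₀ : c ≤ x₀.2 := hcM.trans (sub_le_self M zero_le_one)
  refine preimage_ne_of_upper_end h hm hM (U := connectedComponentIn Kᶜ x₀) (b := -c)
    (fun x hx => subset_connectedComponentIn_of_upper hKc hx₀ (hcM.trans hx)) ?_ ?_
  · intro x hx
    by_contra! hlt
    exact hsep x₀ x hx₀ hlt.le hx
  · have himage : ⇑h '' connectedComponentIn Kᶜ x₀ = connectedComponentIn Kᶜ x₀ := by
      rw [h.image_connectedComponentIn (hKc x₀ hx₀), image_compl_eq h.bijective, hK]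
      refine (connectedComponentIn_eq (subset_connectedComponentIn_of_upper hKc hx₀ ?_)).symm
      rw [hM 0 M le_rfl]
      exact hcM
    nth_rewrite 1 [← himage]
    exact preimage_image_eq _ h.injective
end
end

section
/- There exists an orientation-preserving homeomorphism h of the open annulus 𝔸 = S¹ × ℝ preserving the measure m given by dθ ∧ dt, with h(θ, t) = (θ, t − 1) whenever |t| ≥ 10, together with a lift h̃ of h and two fixed points a and b of h lying in the same chain transitive class of h, such that rot(h̃, a) = 0 and rot(h̃, b) = 1; in particular, the rotation set of that chain transitive class contains the interval [0, 1]. -/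
noncomputable section

open Metric Set Function Filter MeasureTheory Topology Manifold

/-- The vertical shear `(θ, t) ↦ (θ, t + f θ)`. -/
def vShear (f : Circle1 → ℝ) (hf : Continuous f) : Ann ≃ₜ Ann where
  toFun z := (z.1, z.2 + f z.1)
  invFun z := (z.1, z.2 - f z.1)
  left_inv z := by simp
  right_inv z := by simp
  continuous_toFun := by fun_prop
  continuous_invFun := by fun_prop

/-- The horizontal shear `(θ, t) ↦ (θ + u t, t)`. -/
def hShear (u : ℝ → ℝ) (hu : Continuous u) : Ann ≃ₜ Ann where
  toFun z := (z.1 + (u z.2 : Circle1), z.2)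
  invFun z := (z.1 - (u z.2 : Circle1), z.2)
  left_inv z := by simp
  right_inv z := by simp
  continuous_toFun := by
    have := AddCircle.continuous_mk' (1 : ℝ)
    exact (continuous_fst.add (this.comp (hu.comp continuous_snd))).prodMk continuous_snd
  continuous_invFun := by
    have := AddCircle.continuous_mk' (1 : ℝ)
    exact (continuous_fst.sub (this.comp (hu.comp continuous_snd))).prodMk continuous_snd

lemma measurePreserving_vShear (f : Circle1 → ℝ) (hf : Continuous f) :
    MeasurePreserving (vShear f hf) (volume : Measure Ann) volume := by
  refine (MeasurePreserving.id (volume : Measure Circle1)).skew_product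
    (g := fun θ t => t + f θ) (by fun_prop) (Eventually.of_forall fun θ => ?_)
  exact (measurePreserving_add_right (volume : Measure ℝ) (f θ)).map_eq

lemma measurePreserving_hShear (u : ℝ → ℝ) (hu : Continuous u) :
    MeasurePreserving (hShear u hu) (volume : Measure Ann) volume := by
  have hq := AddCircle.continuous_mk' (1 : ℝ)
  have key : MeasurePreserving (fun z : ℝ × Circle1 => (z.1, z.2 + (u z.1 : Circle1)))
      (volume.prod volume) (volume.prod volume) := by
    refine (MeasurePreserving.id (volume : Measure ℝ)).skew_product
      (g := fun t θ => θ + (u t : Circle1)) ?_ (Eventually.of_forall fun t => ?_)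
    · exact (continuous_snd.add (hq.comp (hu.comp continuous_fst))).measurable
    · exact (measurePreserving_add_right (volume : Measure Circle1) _).map_eq
  exact (Measure.measurePreserving_swap.comp key).comp Measure.measurePreserving_swap

/-- A tent of height `2` and slope `8`, centred at `1/8`. -/
def tent (θ : Circle1) : ℝ := max 0 (2 - 8 * ‖θ - ((1 / 8 : ℝ) : Circle1)‖)

/-- A compactly supported function, equal to `1/2` on `[-15/2, 15/2]`. -/
def plateau (c : ℝ) : ℝ := max 0 (min (1 / 2) (8 - |c|))

/-- The profile of the winding: slope `1/16` on `(-∞, 1]` and `[2, ∞)`, rising from `0` at `0`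
to `1` at `3`. -/
def winding (t : ℝ) : ℝ := t / 16 + 13 / 16 * max 0 (min 1 (t - 1))

/-- The winding profile shifted by `-1/2` and cut off to have compact support. -/
def cutWinding (t : ℝ) : ℝ := (winding t - 1 / 2) * max 0 (min 1 (8 - |t|))

lemma continuous_tent : Continuous tent := by unfold tent; fun_prop

lemma continuous_plateau : Continuous plateau := by unfold plateau; fun_prop

lemma continuous_cutWinding : Continuous cutWinding := by
  unfold cutWinding winding; fun_prop

lemma tent_nonneg (θ : Circle1) : 0 ≤ tent θ := le_max_left _ _

lemma tent_le_two (θ : Circle1) : tent θ ≤ 2 :=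
  max_le (by norm_num) (by linarith [norm_nonneg (θ - ((1 / 8 : ℝ) : Circle1))])

lemma tent_coe {x : ℝ} (h1 : -(3 / 8) ≤ x) (h2 : x ≤ 5 / 8) :
    tent (x : Circle1) = max 0 (2 - 8 * |x - 1 / 8|) := by
  have h : ‖((x - 1 / 8 : ℝ) : Circle1)‖ = |x - 1 / 8| := by
    rw [AddCircle.norm_coe_eq_abs_iff (1 : ℝ) one_ne_zero, abs_le]
    constructor <;> norm_num <;> linarith
  rw [tent, ← h, AddCircle.coe_sub]

lemma tent_of_abs_le {x : ℝ} (hx : |x| ≤ 1 / 8) : tent (x : Circle1) = 1 + 8 * x := by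
  obtain ⟨h1, h2⟩ := abs_le.1 hx
  rw [tent_coe (by linarith) (by linarith), abs_of_nonpos (by linarith),
    max_eq_right (by linarith)]
  ring

lemma tent_add_half {x : ℝ} (hx : |x| ≤ 1 / 8) :
    tent ((x : Circle1) + ((1 / 2 : ℝ) : Circle1)) = 0 := by
  obtain ⟨h1, h2⟩ := abs_le.1 hx
  rw [← AddCircle.coe_add, tent_coe (by linarith) (by linarith), abs_of_nonneg (by linarith),
    max_eq_left (by linarith)]

lemma plateau_of_abs_le {c : ℝ} (hc : |c| ≤ 7) : plateau c = 1 / 2 := by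
  rw [plateau, min_eq_left (by linarith), max_eq_right (by norm_num)]

lemma plateau_of_le_abs {c : ℝ} (hc : 8 ≤ |c|) : plateau c = 0 := by
  rw [plateau, min_eq_right (by linarith), max_eq_left (by linarith)]

lemma cutWinding_of_abs_le {t : ℝ} (ht : |t| ≤ 7) : cutWinding t = winding t - 1 / 2 := by
  rw [cutWinding, min_eq_left (by linarith), max_eq_right (by norm_num), mul_one]

lemma cutWinding_of_le_abs {t : ℝ} (ht : 8 ≤ |t|) : cutWinding t = 0 := by
  rw [cutWinding, min_eq_right (by linarith), max_eq_left (by linarith), mul_zero]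

lemma winding_of_le_one {t : ℝ} (ht : t ≤ 1) : winding t = t / 16 := by
  rw [winding, min_eq_right (by linarith), max_eq_left (by linarith)]; ring

lemma winding_of_two_le {t : ℝ} (ht : 2 ≤ t) : winding t = (t + 13) / 16 := by
  rw [winding, min_eq_left (by linarith), max_eq_right (by norm_num)]; ring

/-- The winding map, together with its isotopy to the identity: at time `s` the twists and the
downward translation are scaled by `s`. -/
def windingIsotopy (s : ℝ) : Ann ≃ₜ Ann :=
  (vShear tent continuous_tent).trans <|
    (hShear (fun c => s * plateau c) (continuous_plateau.const_mul s)).trans <|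
      (vShear (fun θ => -s - tent θ) (continuous_const.sub continuous_tent)).trans <|
        hShear (fun t => s * cutWinding t) (continuous_cutWinding.const_mul s)

/-- The winding map. -/
def windingMap : Ann ≃ₜ Ann := windingIsotopy 1

/-- The height reached by the winding map. -/
def windingHeight (z : Ann) : ℝ :=
  z.2 + tent z.1 + (-1 - tent (z.1 + (plateau (z.2 + tent z.1) : Circle1)))

/-- The horizontal displacement of the lifted winding map. -/
def windingDisp (z : Ann) : ℝ := plateau (z.2 + tent z.1) + cutWinding (windingHeight z)

lemma windingMap_apply (z : Ann) :
    windingMap z = (z.1 + (windingDisp z : Circle1), windingHeight z) := by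
  simp [windingMap, windingIsotopy, vShear, hShear, windingDisp, windingHeight, add_assoc]

lemma isotopicToId_windingMap : IsotopicToId windingMap := by
  refine ⟨windingIsotopy, ?_, ?_, rfl⟩
  · have hq := AddCircle.continuous_mk' (1 : ℝ)
    have hp := continuous_plateau
    have hc := continuous_cutWinding
    have ht := continuous_tent
    have hA : Continuous fun p : ℝ × Ann =>
        p.2.1 + ((p.1 * plateau (p.2.2 + tent p.2.1) : ℝ) : Circle1) :=
      (continuous_fst.comp continuous_snd).add (hq.comp (by fun_prop))
    have hB : Continuous fun p : ℝ × Ann => p.2.2 + tent p.2.1 +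
        (-p.1 - tent (p.2.1 + ((p.1 * plateau (p.2.2 + tent p.2.1) : ℝ) : Circle1))) := by
      fun_prop
    exact (hA.add (hq.comp (continuous_fst.mul (hc.comp hB)))).prodMk hB
  · ext z <;> simp [windingIsotopy, vShear, hShear]

lemma measurePreserving_windingMap :
    MeasurePreserving windingMap (volume : Measure Ann) volume :=
  (measurePreserving_hShear _ (continuous_cutWinding.const_mul 1)).comp <|
    (measurePreserving_vShear _ (continuous_const.sub continuous_tent)).comp <|
      (measurePreserving_hShear _ (continuous_plateau.const_mul 1)).comp <|
        measurePreserving_vShear _ continuous_tent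

lemma continuous_windingHeight : Continuous windingHeight := by
  have hq := AddCircle.continuous_mk' (1 : ℝ)
  have hp := continuous_plateau
  have ht := continuous_tent
  have hA : Continuous fun z : Ann => z.1 + (plateau (z.2 + tent z.1) : Circle1) :=
    continuous_fst.add (hq.comp (by fun_prop))
  unfold windingHeight
  fun_prop

lemma continuous_windingDisp : Continuous windingDisp := by
  have hp := continuous_plateau
  have hc := continuous_cutWinding
  have ht := continuous_tent
  have hh := continuous_windingHeight
  unfold windingDisp
  fun_prop

lemma windingMap_of_le_abs (θ : Circle1) (t : ℝ) (ht : 10 ≤ |t|) :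
    windingMap (θ, t) = (θ, t - 1) := by
  have h0 := tent_nonneg θ
  have h2 := tent_le_two θ
  have hp : plateau (t + tent θ) = 0 := by
    apply plateau_of_le_abs
    rcases le_abs.1 ht with h | h <;> rw [le_abs]
    · left; linarith
    · right; linarith
  have hh : windingHeight (θ, t) = t - 1 := by simp [windingHeight, hp]; ring
  have hc : cutWinding (t - 1) = 0 := by
    apply cutWinding_of_le_abs
    rcases le_abs.1 ht with h | h <;> rw [le_abs]
    · left; linarith
    · right; linarith
  simp [windingMap_apply, windingDisp, hh, hp, hc]

lemma windingHeight_coe {x t : ℝ} (hx : |x| ≤ 1 / 8) (h0 : 0 ≤ t + 8 * x) (h3 : t + 8 * x ≤ 3) :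
    windingHeight ((x : Circle1), t) = t + 8 * x := by
  have hp : plateau (t + (1 + 8 * x)) = 1 / 2 :=
    plateau_of_abs_le (by rw [abs_le]; constructor <;> linarith)
  simp only [windingHeight, tent_of_abs_le hx, hp, tent_add_half hx]
  ring

lemma windingDisp_coe {x t : ℝ} (hx : |x| ≤ 1 / 8) (h0 : 0 ≤ t + 8 * x) (h3 : t + 8 * x ≤ 3) :
    windingDisp ((x : Circle1), t) = winding (t + 8 * x) := by
  have hp : plateau (t + (1 + 8 * x)) = 1 / 2 :=
    plateau_of_abs_le (by rw [abs_le]; constructor <;> linarith)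
  rw [windingDisp, windingHeight_coe hx h0 h3,
    cutWinding_of_abs_le (by rw [abs_le]; constructor <;> linarith)]
  simp only [tent_of_abs_le hx, hp]
  ring

/-- On the strip `|x| ≤ 1/8` the winding map is a standard-like map. -/
lemma windingMap_coe {x t x' t' : ℝ} (n : ℤ) (hx : |x| ≤ 1 / 8) (h0 : 0 ≤ t') (h3 : t' ≤ 3)
    (ht : t + 8 * x = t') (hx' : x + winding t' = x' + n) :
    windingMap ((x : Circle1), t) = ((x' : Circle1), t') := by
  subst ht
  rw [windingMap_apply, windingDisp_coe hx h0 h3, windingHeight_coe hx h0 h3, ← AddCircle.coe_add,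
    hx', AddCircle.coe_add]
  have : (((n : ℝ)) : Circle1) = 0 := by
    rw [AddCircle.coe_eq_zero_iff]; exact ⟨n, by simp⟩
  rw [this, add_zero]

section Chains

variable {X : Type*} [MetricSpace X] {h : X → X} {ε : ℝ}

lemma EpsChainFromTo.single {x y : X} (hxy : dist (h x) y < ε) : EpsChainFromTo h ε x y :=
  ⟨1, fun i => if i = 0 then x else y, ⟨le_rfl, fun i hi => by
    obtain rfl : i = 0 := by omega
    simpa using hxy⟩, by simp, by simp⟩

lemma EpsChainFromTo.trans {x y w : X} (h₁ : EpsChainFromTo h ε x y)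
    (h₂ : EpsChainFromTo h ε y w) : EpsChainFromTo h ε x w := by
  obtain ⟨r, z, ⟨hr, hz⟩, rfl, rfl⟩ := h₁
  obtain ⟨r', z', ⟨hr', hz'⟩, h0, rfl⟩ := h₂
  refine ⟨r + r', fun i => if i ≤ r then z i else z' (i - r), ⟨by omega, fun i hi => ?_⟩,
    by simp, ?_⟩
  · rcases lt_trichotomy i r with hlt | rfl | hgt
    · simpa [hlt.le, Nat.succ_le_of_lt hlt] using hz i hlt
    · simpa [← h0] using hz' 0 (by omega)
    · have e : i + 1 - r = i - r + 1 := by omega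
      simpa [show ¬ i ≤ r by omega, show ¬ i + 1 ≤ r by omega, e] using hz' (i - r) (by omega)
  · simp [show ¬ r' = 0 by omega]

/-- A heteroclinic orbit from `a` to `b`, given by its backward half `p` and forward half `q`,
yields `ε`-chains from `a` to `b`. -/
lemma epsChainFromTo_of_heteroclinic {a b : X} {p q : ℕ → X} (hε : 0 < ε) (ha : h a = a)
    (hp : ∀ n, h (p (n + 1)) = p n) (hpq : h (p 0) = q 0) (hq : ∀ n, h (q n) = q (n + 1))
    (hpa : Tendsto p atTop (𝓝 a)) (hqb : Tendsto q atTop (𝓝 b)) : EpsChainFromTo h ε a b := by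
  have orbit {x y : X} (hxy : h x = y) : EpsChainFromTo h ε x y := .single (by simpa [hxy])
  have hback (n : ℕ) : EpsChainFromTo h ε (p n) (q 0) := by
    induction n with
    | zero => exact orbit hpq
    | succ n ih => exact (orbit (hp n)).trans ih
  obtain ⟨N, hN⟩ := (Metric.tendsto_nhds.1 hpa ε hε).exists
  have hfwd (m : ℕ) : EpsChainFromTo h ε a (q m) := by
    induction m with
    | zero => exact (EpsChainFromTo.single (by rwa [ha, dist_comm])).trans (hback N)
    | succ m ih => exact ih.trans (orbit (hq m))
  obtain ⟨M, hM⟩ := ((tendsto_add_atTop_iff_nat 1).2 hqb |>.eventually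
    (Metric.ball_mem_nhds b hε)).exists
  exact (hfwd M).trans (.single (by rw [hq]; exact hM))

end Chains

lemma tendsto_coe_prodMk {f g : ℕ → ℝ} {x t : ℝ} (hf : Tendsto f atTop (𝓝 x))
    (hg : Tendsto g atTop (𝓝 t)) :
    Tendsto (fun n => (((f n : Circle1), g n) : Ann)) atTop (𝓝 ((x : Circle1), t)) :=
  (((AddCircle.continuous_mk' (1 : ℝ)).tendsto x).comp hf).prodMk_nhds hg

lemma tendsto_add_const_mul_half_pow (x c : ℝ) :
    Tendsto (fun n : ℕ => x + c * (1 / 2 : ℝ) ^ n) atTop (𝓝 x) := by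
  simpa using ((tendsto_pow_atTop_nhds_zero_of_lt_one (r := (1 / 2 : ℝ))
    (by norm_num) (by norm_num)).const_mul c).const_add x

lemma half_pow_bounds (n : ℕ) : 0 < (1 / 2 : ℝ) ^ n ∧ (1 / 2 : ℝ) ^ n ≤ 1 :=
  ⟨by positivity, pow_le_one₀ (by norm_num) (by norm_num)⟩

lemma windingMap_fixed_zero : windingMap (((0 : ℝ) : Circle1), 0) = (((0 : ℝ) : Circle1), 0) :=
  windingMap_coe 0 (by norm_num) le_rfl (by norm_num) (by norm_num)
    (by rw [winding_of_le_one (by norm_num)]; norm_num)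

lemma windingMap_fixed_three : windingMap (((0 : ℝ) : Circle1), 3) = (((0 : ℝ) : Circle1), 3) :=
  windingMap_coe 1 (by norm_num) (by norm_num) le_rfl (by norm_num)
    (by rw [winding_of_two_le (by norm_num)]; norm_num)

lemma epsChain_zero_three {ε : ℝ} (hε : 0 < ε) :
    EpsChainFromTo windingMap ε (((0 : ℝ) : Circle1), 0) (((0 : ℝ) : Circle1), 3) := by
  refine epsChainFromTo_of_heteroclinic hε windingMap_fixed_zero
    (p := fun n => (((0 + 1 / 8 * (1 / 2 : ℝ) ^ n : ℝ) : Circle1), 0 + 1 * (1 / 2 : ℝ) ^ n))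
    (q := fun n => (((0 + 1 / 16 * (1 / 2 : ℝ) ^ n : ℝ) : Circle1), 3 + -1 * (1 / 2 : ℝ) ^ n))
    (fun n => ?_) ?_ (fun n => ?_)
    (tendsto_coe_prodMk (tendsto_add_const_mul_half_pow _ _) (tendsto_add_const_mul_half_pow _ _))
    (tendsto_coe_prodMk (tendsto_add_const_mul_half_pow _ _) (tendsto_add_const_mul_half_pow _ _))
  · obtain ⟨h0, h1⟩ := half_pow_bounds n
    simp only [pow_succ]
    refine windingMap_coe 0 (abs_le.2 ⟨by linarith, by linarith⟩) (by linarith) (by linarith)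
      (by ring) ?_
    rw [winding_of_le_one (by linarith)]
    push_cast
    ring
  · simp only [pow_zero]
    refine windingMap_coe 1 (abs_le.2 ⟨by linarith, by linarith⟩) (by linarith) (by linarith)
      (by ring) ?_
    rw [winding_of_two_le (by linarith)]
    push_cast
    ring
  · obtain ⟨h0, h1⟩ := half_pow_bounds n
    simp only [pow_succ]
    refine windingMap_coe 1 (abs_le.2 ⟨by linarith, by linarith⟩) (by linarith) (by linarith)
      (by ring) ?_
    rw [winding_of_two_le (by linarith)]
    push_cast
    ring

lemma epsChain_three_zero {ε : ℝ} (hε : 0 < ε) :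
    EpsChainFromTo windingMap ε (((0 : ℝ) : Circle1), 3) (((0 : ℝ) : Circle1), 0) := by
  refine epsChainFromTo_of_heteroclinic hε windingMap_fixed_three
    (p := fun n => (((0 + -(1 / 8) * (1 / 2 : ℝ) ^ n : ℝ) : Circle1), 3 + -1 * (1 / 2 : ℝ) ^ n))
    (q := fun n => (((0 + -(1 / 16) * (1 / 2 : ℝ) ^ n : ℝ) : Circle1), 0 + 1 * (1 / 2 : ℝ) ^ n))
    (fun n => ?_) ?_ (fun n => ?_)
    (tendsto_coe_prodMk (tendsto_add_const_mul_half_pow _ _) (tendsto_add_const_mul_half_pow _ _))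
    (tendsto_coe_prodMk (tendsto_add_const_mul_half_pow _ _) (tendsto_add_const_mul_half_pow _ _))
  · obtain ⟨h0, h1⟩ := half_pow_bounds n
    simp only [pow_succ]
    refine windingMap_coe 1 (abs_le.2 ⟨by linarith, by linarith⟩) (by linarith) (by linarith)
      (by ring) ?_
    rw [winding_of_two_le (by linarith)]
    push_cast
    ring
  · simp only [pow_zero]
    refine windingMap_coe 0 (abs_le.2 ⟨by linarith, by linarith⟩) (by linarith) (by linarith)
      (by ring) ?_
    rw [winding_of_le_one (by linarith)]
    push_cast
    ring
  · obtain ⟨h0, h1⟩ := half_pow_bounds n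
    simp only [pow_succ]
    refine windingMap_coe 0 (abs_le.2 ⟨by linarith, by linarith⟩) (by linarith) (by linarith)
      (by ring) ?_
    rw [winding_of_le_one (by linarith)]
    push_cast
    ring

lemma chainEquiv_of_epsChain {X : Type*} [MetricSpace X] {h : X → X} {a b : X}
    (hab : ∀ ε > 0, EpsChainFromTo h ε a b) (hba : ∀ ε > 0, EpsChainFromTo h ε b a) :
    ChainEquiv h a b :=
  ⟨fun ε hε => (hab ε hε).trans (hba ε hε), fun ε hε => (hba ε hε).trans (hab ε hε),
    fun ε hε => ⟨hab ε hε, hba ε hε⟩⟩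

/-- Convex combinations of Dirac masses at two fixed points realise all rotation numbers between
those of the fixed points. -/
lemma Icc_subset_rotSet {hA : Ann → Ann} {φ : Ann → ℝ} {K : Set Ann} {a b : Ann}
    (hm : Measurable hA) (ha : hA a = a) (hb : hA b = b) (haK : a ∈ K) (hbK : b ∈ K)
    (hφa : φ a = 0) (hφb : φ b = 1) : Set.Icc (0 : ℝ) 1 ⊆ rotSet hA φ K := by
  rintro s ⟨h0, h1⟩
  refine ⟨ENNReal.ofReal (1 - s) • Measure.dirac a + ENNReal.ofReal s • Measure.dirac b,
    ⟨?_⟩, ?_, ?_, ?_⟩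
  · simp only [Measure.add_apply, Measure.smul_apply, measure_univ, smul_eq_mul, mul_one]
    rw [← ENNReal.ofReal_add (by linarith) h0]
    simp
  · rw [Measure.map_add _ _ hm, Measure.map_smul, Measure.map_smul, Measure.map_dirac' hm,
      Measure.map_dirac' hm, ha, hb]
  · simp [haK, hbK]
  · rw [rotMeas, integral_add_measure, integral_smul_measure, integral_smul_measure,
      integral_dirac, integral_dirac, hφa, hφb, ENNReal.toReal_ofReal h0]
    · simp
    · exact (integrable_dirac (by simp)).smul_measure ENNReal.ofReal_ne_top
    · exact (integrable_dirac (by simp)).smul_measure ENNReal.ofReal_ne_top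

/-- Section 3.2: the winding horseshoe example — an area-preserving, orientation-preserving
annulus homeomorphism with two fixed points in the same chain transitive class having
rotation numbers `0` and `1`; in particular the rotation set of that class contains `[0,1]`. -/
theorem statement19 :
    ∃ (h : Ann ≃ₜ Ann) (ht : ℝ × ℝ → ℝ × ℝ) (φ : Ann → ℝ) (a b : Ann),
      IsotopicToId h ∧
      MeasurePreserving (⇑h) (volume : Measure Ann) volume ∧
      (∀ (θ : Circle1) (t : ℝ), 10 ≤ |t| → h (θ, t) = (θ, t - 1)) ∧
      IsAnnulusLift (⇑h) ht ∧ DescendsTo ht φ ∧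
      h a = a ∧ h b = b ∧ ChainEquiv (⇑h) a b ∧
      φ a = 0 ∧ φ b = 1 ∧
      Set.Icc (0 : ℝ) 1 ⊆ rotSet (⇑h) φ {y | ChainEquiv (⇑h) a y} := by
  have hab : ChainEquiv windingMap (((0 : ℝ) : Circle1), 0) (((0 : ℝ) : Circle1), 3) :=
    chainEquiv_of_epsChain (fun _ => epsChain_zero_three) (fun _ => epsChain_three_zero)
  have hφa : windingDisp (((0 : ℝ) : Circle1), 0) = 0 := by
    rw [windingDisp_coe (by norm_num) (by norm_num) (by norm_num),
      winding_of_le_one (by norm_num)]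
    norm_num
  have hφb : windingDisp (((0 : ℝ) : Circle1), 3) = 1 := by
    rw [windingDisp_coe (by norm_num) (by norm_num) (by norm_num),
      winding_of_two_le (by norm_num)]
    norm_num
  have hP : Continuous annP :=
    ((AddCircle.continuous_mk' (1 : ℝ)).comp continuous_fst).prodMk continuous_snd
  refine ⟨windingMap, fun p => (p.1 + windingDisp (annP p), windingHeight (annP p)), windingDisp,
    (((0 : ℝ) : Circle1), 0), (((0 : ℝ) : Circle1), 3), isotopicToId_windingMap,
    measurePreserving_windingMap, windingMap_of_le_abs, ⟨?_, fun p => ?_⟩,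
    ⟨continuous_windingDisp, fun p => by simp⟩, windingMap_fixed_zero, windingMap_fixed_three, hab,
    hφa, hφb, Icc_subset_rotSet measurePreserving_windingMap.measurable windingMap_fixed_zero
      windingMap_fixed_three ?_ hab hφa hφb⟩
  · have := continuous_windingDisp
    have := continuous_windingHeight
    fun_prop
  · rw [windingMap_apply]
    simp [annP]
  · exact ⟨hab.1, hab.1, fun ε hε => ⟨hab.1 ε hε, hab.1 ε hε⟩⟩
end
end
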